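/- Density estimates for finite Morse index solutions (Euclidean version): let n ≥ 1, s ∈ (0,1) and m ∈ ℕ. There exist positive constants ω₀ and C₀, depending only on n, s and m, such that the following holds. Let R > 0, ε > 0 with R ≥ C₀·ε, let p ∈ ℝ^n, and let u : ℝ^n → (-1,1) be a continuously differentiable solution of the fractional Allen–Cahn equation with parameters s, ε in B_R(p) ⊆ ℝ^n with bounded gradient and Morse index at most m in B_R(p). If R^{-n}·∫_{B_R(p)} |1+u| dx ≤ ω₀, then u < -9/10 everywhere on B_{R/2}(p); symmetrically, if R^{-n}·∫_{B_R(p)} |1-u| dx ≤ ω₀, then u > 9/10 everywhere on B_{R/2}(p). -/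

import Mathlib

open MeasureTheory Real Set Metric Filter Topology

noncomputable section

/-- Euclidean `n`-space. -/
abbrev Rn (n : ℕ) : Type := EuclideanSpace ℝ (Fin n)

/-- The normalizing constant `α_{n,s}` of the fractional Laplacian kernel. -/
def alphaC (n : ℕ) (s : ℝ) : ℝ :=
  s * 2 ^ (s - 1) * Real.Gamma (((n : ℝ) + s) / 2) /
    (Real.pi ^ ((n : ℝ) / 2) * Real.Gamma (1 - s / 2))

/-- The fractional kernel `α_{n,s} |x-y|^{-(n+s)}`. -/
def fracKer (n : ℕ) (s : ℝ) (x y : Rn n) : ℝ :=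
  alphaC n s * ‖x - y‖ ^ (-((n : ℝ) + s))

/-- The double-well potential `W(t) = (1-t²)²/4`. -/
def Wpot (t : ℝ) : ℝ := (1 - t ^ 2) ^ 2 / 4

/-- `u` solves the fractional Allen–Cahn equation
`(-Δ)^{s/2} u + ε^{-s} W'(u) = 0` (with `W'(t) = t³ - t`) in the open set `O`. -/
def IsACSol (n : ℕ) (s ε : ℝ) (u : Rn n → ℝ) (O : Set (Rn n)) : Prop :=
  ∀ x ∈ O, (∫ y, (u x - u y) * fracKer n s x y) + ε ^ (-s) * (u x ^ 3 - u x) = 0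

/-- The second-variation quadratic form of the fractional Allen–Cahn energy at `u` in `Ω`,
with `W''(t) = 3t² - 1`. -/
def Qform (n : ℕ) (s ε : ℝ) (u : Rn n → ℝ) (Ω : Set (Rn n)) (ξ : Rn n → ℝ) : ℝ :=
  (1 / 4) * (∫ p in ((Ωᶜ ×ˢ Ωᶜ)ᶜ : Set (Rn n × Rn n)),
      (ξ p.1 - ξ p.2) ^ 2 * fracKer n s p.1 p.2) +
    ε ^ (-s) * ∫ x in Ω, (3 * u x ^ 2 - 1) * ξ x ^ 2

/-- `ξ` is a `C¹` function compactly supported in `Ω`. -/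
def IsCc1On (n : ℕ) (Ω : Set (Rn n)) (ξ : Rn n → ℝ) : Prop :=
  ContDiff ℝ 1 ξ ∧ HasCompactSupport ξ ∧ tsupport ξ ⊆ Ω

/-- The Morse index of `u` in `Ω` is at most `m`: there is no `(m+1)`-dimensional subspace
of `C_c¹(Ω)` on which the second variation is negative definite. -/
def ACMorseIndexLE (n : ℕ) (s ε : ℝ) (u : Rn n → ℝ) (Ω : Set (Rn n)) (m : ℕ) : Prop :=
  ∀ ξ : Fin (m + 1) → Rn n → ℝ, (∀ i, IsCc1On n Ω (ξ i)) → LinearIndependent ℝ ξ →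
    ∃ a : Fin (m + 1) → ℝ, a ≠ 0 ∧ 0 ≤ Qform n s ε u Ω (fun x => ∑ i, a i * ξ i x)

/-- `u` is `Λ`-almost stable in `Ω`: `Q_Ω(ξ) ≥ -Λ (∫_Ω |ξ|)²` for all `ξ ∈ C_c¹(Ω)`. -/
def AlmostStable (n : ℕ) (s ε Λ : ℝ) (u : Rn n → ℝ) (Ω : Set (Rn n)) : Prop :=
  ∀ ξ : Rn n → ℝ, IsCc1On n Ω ξ → -(Λ * (∫ x in Ω, |ξ x|) ^ 2) ≤ Qform n s ε u Ω ξ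

end

section Kernel

variable {n : ℕ} {s : ℝ}

/-- The translation-invariant profile `α_{n,s} |z|^{-(n+s)}` of the fractional kernel. -/
noncomputable def fker (n : ℕ) (s : ℝ) (z : Rn n) : ℝ := alphaC n s * ‖z‖ ^ (-((n : ℝ) + s))

/-- The kernel profile truncated at distance `δ` from its singularity. -/
noncomputable def tker (n : ℕ) (s δ : ℝ) (z : Rn n) : ℝ :=
  alphaC n s * (max ‖z‖ δ) ^ (-((n : ℝ) + s))

/-- The constant `∫ min(1,|z|) α_{n,s} |z|^{-(n+s)} dz`. -/
noncomputable def kerMass (n : ℕ) (s : ℝ) : ℝ := ∫ z : Rn n, min 1 ‖z‖ * fker n s z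

theorem alphaC_pos (hn : 1 ≤ n) (hs : s ∈ Ioo (0 : ℝ) 1) : 0 < alphaC n s := by
  obtain ⟨h0, h1⟩ := hs
  have hn' : (1 : ℝ) ≤ n := by exact_mod_cast hn
  have := Real.Gamma_pos_of_pos (s := ((n : ℝ) + s) / 2) (by positivity)
  have := Real.Gamma_pos_of_pos (s := 1 - s / 2) (by linarith)
  unfold alphaC
  positivity

theorem neg_exponent_nonpos (hs : s ∈ Ioo (0 : ℝ) 1) : -((n : ℝ) + s) ≤ 0 := by
  have := hs.1
  have : (0 : ℝ) ≤ n := n.cast_nonneg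
  linarith

theorem ker_nonneg (hn : 1 ≤ n) (hs : s ∈ Ioo (0 : ℝ) 1) (z : Rn n) : 0 ≤ fker n s z :=
  mul_nonneg (alphaC_pos hn hs).le (rpow_nonneg (norm_nonneg _) _)

theorem tker_nonneg (hn : 1 ≤ n) (hs : s ∈ Ioo (0 : ℝ) 1) (δ : ℝ) (z : Rn n) :
    0 ≤ tker n s δ z :=
  mul_nonneg (alphaC_pos hn hs).le (rpow_nonneg (le_max_of_le_left (norm_nonneg _)) _)

theorem measurable_ker : Measurable (fker n s) := by
  unfold fker; fun_prop

theorem measurable_tker (δ : ℝ) : Measurable (tker n s δ) := by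
  unfold tker; fun_prop

theorem tker_le_ker (hn : 1 ≤ n) (hs : s ∈ Ioo (0 : ℝ) 1) {δ : ℝ} {z : Rn n}
    (hz : z ≠ 0) : tker n s δ z ≤ fker n s z := by
  have hz' : 0 < ‖z‖ := norm_pos_iff.2 hz
  refine mul_le_mul_of_nonneg_left ?_ (alphaC_pos hn hs).le
  exact rpow_le_rpow_of_nonpos hz' (le_max_left _ _) (neg_exponent_nonpos hs)

theorem tker_eq_ker {δ : ℝ} {z : Rn n} (hz : δ ≤ ‖z‖) : tker n s δ z = fker n s z := by
  simp [tker, fker, max_eq_left hz]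

theorem tker_anti (hn : 1 ≤ n) (hs : s ∈ Ioo (0 : ℝ) 1) {δ : ℝ} (hδ : 0 < δ) {z w : Rn n}
    (h : ‖z‖ ≤ ‖w‖) : tker n s δ w ≤ tker n s δ z := by
  refine mul_le_mul_of_nonneg_left ?_ (alphaC_pos hn hs).le
  exact rpow_le_rpow_of_nonpos (lt_max_of_lt_right hδ) (max_le_max_right _ h)
    (neg_exponent_nonpos hs)

theorem tker_congr_norm {δ : ℝ} {z w : Rn n} (h : ‖z‖ = ‖w‖) : tker n s δ z = tker n s δ w := by
  simp [tker, h]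

theorem le_tker (hn : 1 ≤ n) (hs : s ∈ Ioo (0 : ℝ) 1) {δ r : ℝ} (hδ : 0 < δ) {z : Rn n}
    (h : ‖z‖ ≤ r) (hr : δ ≤ r) : alphaC n s * r ^ (-((n : ℝ) + s)) ≤ tker n s δ z := by
  refine mul_le_mul_of_nonneg_left ?_ (alphaC_pos hn hs).le
  exact rpow_le_rpow_of_nonpos (lt_max_of_lt_right hδ) (max_le h hr)
    (neg_exponent_nonpos hs)

theorem tker_le (hn : 1 ≤ n) (hs : s ∈ Ioo (0 : ℝ) 1) {δ r : ℝ} {z : Rn n} (hr : 0 < r)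
    (h : r ≤ max ‖z‖ δ) : tker n s δ z ≤ alphaC n s * r ^ (-((n : ℝ) + s)) := by
  refine mul_le_mul_of_nonneg_left ?_ (alphaC_pos hn hs).le
  exact rpow_le_rpow_of_nonpos hr h (neg_exponent_nonpos hs)

theorem nontrivial_Rn (hn : 1 ≤ n) : Nontrivial (Rn n) := by
  have : Nonempty (Fin n) := ⟨⟨0, hn⟩⟩
  exact Module.nontrivial_of_finrank_pos (R := ℝ) (by rw [finrank_euclideanSpace_fin]; omega)

theorem integrable_min_mul_ker_one (hn : 1 ≤ n) (hs : s ∈ Ioo (0 : ℝ) 1) :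
    Integrable (fun z : Rn n => min 1 ‖z‖ * fker n s z) := by
  have := nontrivial_Rn hn
  obtain ⟨h0, h1⟩ := hs
  have key := (integrable_fun_norm_addHaar (E := Rn n) volume
    (f := fun r : ℝ => min 1 r * (alphaC n s * r ^ (-((n : ℝ) + s))))).2
  refine key ?_
  rw [finrank_euclideanSpace_fin, ← Ioc_union_Ioi_eq_Ioi zero_le_one]
  have e : ∀ y : ℝ, 0 < y → y ^ (n - 1) = y ^ ((n : ℝ) - 1) := by
    intro y hy
    rw [← rpow_natCast, Nat.cast_sub hn, Nat.cast_one]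
  refine IntegrableOn.union ?_ ?_
  · have h := (intervalIntegral.integrableOn_Ioo_rpow_iff (s := -s) zero_lt_one).2 (by linarith)
    rw [integrableOn_Ioc_iff_integrableOn_Ioo]
    refine IntegrableOn.congr_fun (h.const_mul (alphaC n s)) ?_ measurableSet_Ioo
    intro y hy
    simp only [smul_eq_mul]
    rw [e y hy.1, min_eq_right hy.2.le, show -s = ((n : ℝ) - 1) + 1 + (-((n : ℝ) + s)) by ring,
      rpow_add hy.1, rpow_add hy.1, rpow_one]
    ring
  · have h := integrableOn_Ioi_rpow_of_lt (a := -1 - s) (c := 1) (by linarith) zero_lt_one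
    refine IntegrableOn.congr_fun (h.const_mul (alphaC n s)) ?_ measurableSet_Ioi
    intro y hy
    have hy' : (1 : ℝ) < y := hy
    have hy0 : 0 < y := by linarith
    simp only [smul_eq_mul]
    rw [e y hy0, min_eq_left hy'.le, show -1 - s = ((n : ℝ) - 1) + (-((n : ℝ) + s)) by ring,
      rpow_add hy0]
    ring

theorem min_mul_ker_scale {r : ℝ} (hr : 0 < r) (z : Rn n) :
    min 1 (‖z‖ / r) * fker n s z
      = r ^ (-((n : ℝ) + s)) * (min 1 ‖r⁻¹ • z‖ * fker n s (r⁻¹ • z)) := by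
  have : ‖r⁻¹ • z‖ = ‖z‖ / r := by
    rw [norm_smul, norm_inv, norm_of_nonneg hr.le]; field_simp
  unfold fker
  rw [this, div_rpow (norm_nonneg _) hr.le]
  have := (rpow_pos_of_pos hr (-((n : ℝ) + s))).ne'
  field_simp

theorem integrable_min_mul_ker (hn : 1 ≤ n) (hs : s ∈ Ioo (0 : ℝ) 1) {r : ℝ} (hr : 0 < r) :
    Integrable (fun z : Rn n => min 1 (‖z‖ / r) * fker n s z) := by
  simp_rw [min_mul_ker_scale hr]
  exact ((integrable_min_mul_ker_one hn hs).comp_smul (inv_ne_zero hr.ne')).const_mul _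

theorem integral_min_mul_ker {r : ℝ} (hr : 0 < r) :
    ∫ z : Rn n, min 1 (‖z‖ / r) * fker n s z = r ^ (-s) * kerMass n s := by
  simp_rw [min_mul_ker_scale hr]
  rw [integral_const_mul,
    Measure.integral_comp_inv_smul_of_nonneg volume
      (fun z : Rn n => min 1 ‖z‖ * fker n s z) hr.le,
    finrank_euclideanSpace_fin, smul_eq_mul, ← mul_assoc, ← rpow_natCast, ← rpow_add hr, kerMass]
  ring_nf

theorem kerMass_nonneg (hn : 1 ≤ n) (hs : s ∈ Ioo (0 : ℝ) 1) : 0 ≤ kerMass n s :=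
  integral_nonneg fun z => mul_nonneg (le_min zero_le_one (norm_nonneg _)) (ker_nonneg hn hs z)

theorem integrable_mul_ker (hn : 1 ≤ n) (hs : s ∈ Ioo (0 : ℝ) 1) {r M : ℝ} (hr : 0 < r)
    {g : Rn n → ℝ} (hg : Measurable g) (hb : ∀ z, |g z| ≤ M * min 1 (‖z‖ / r)) :
    Integrable (fun z => g z * fker n s z) := by
  refine ((integrable_min_mul_ker hn hs hr).const_mul M).mono'
    (hg.mul measurable_ker).aestronglyMeasurable (ae_of_all _ fun z => ?_)
  rw [norm_mul, norm_eq_abs, norm_of_nonneg (ker_nonneg hn hs z), ← mul_assoc]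
  exact mul_le_mul_of_nonneg_right (hb z) (ker_nonneg hn hs z)

theorem integral_mul_ker_le (hn : 1 ≤ n) (hs : s ∈ Ioo (0 : ℝ) 1) {r M : ℝ} (hr : 0 < r)
    {g : Rn n → ℝ} (hg : Measurable g) (hb : ∀ z, |g z| ≤ M * min 1 (‖z‖ / r)) :
    ∫ z, g z * fker n s z ≤ M * (r ^ (-s) * kerMass n s) := by
  rw [← integral_min_mul_ker hr, ← integral_const_mul]
  refine integral_mono (integrable_mul_ker hn hs hr hg hb)
    ((integrable_min_mul_ker hn hs hr).const_mul M) fun z => ?_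
  simp only
  rw [← mul_assoc]
  exact mul_le_mul_of_nonneg_right ((le_abs_self _).trans (hb z)) (ker_nonneg hn hs z)

theorem integrable_tker (hn : 1 ≤ n) (hs : s ∈ Ioo (0 : ℝ) 1) {δ : ℝ} (hδ : 0 < δ) :
    Integrable (tker n s δ) := by
  have h2 : Integrable ((ball (0 : Rn n) δ).indicator
      fun _ => alphaC n s * δ ^ (-((n : ℝ) + s))) :=
    (integrable_indicator_iff measurableSet_ball).2
      (integrableOn_const measure_ball_lt_top.ne)
  refine ((integrable_min_mul_ker hn hs hδ).add h2).mono'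
    (measurable_tker δ).aestronglyMeasurable (ae_of_all _ fun z => ?_)
  rw [norm_of_nonneg (tker_nonneg hn hs δ z), Pi.add_apply]
  by_cases hz : ‖z‖ < δ
  · rw [indicator_of_mem (by simpa using hz)]
    have := tker_le hn hs (z := z) hδ (le_max_right ‖z‖ δ)
    have := mul_nonneg (le_min zero_le_one (div_nonneg (norm_nonneg z) hδ.le))
      (ker_nonneg hn hs z)
    linarith
  · push Not at hz
    rw [indicator_of_notMem (by simpa using hz), tker_eq_ker hz,
      min_eq_left ((one_le_div hδ).2 hz)]
    simp

theorem integrable_mul_tker (hn : 1 ≤ n) (hs : s ∈ Ioo (0 : ℝ) 1) {δ M : ℝ} (hδ : 0 < δ)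
    {g : Rn n → ℝ} (hg : Measurable g) (hb : ∀ z, |g z| ≤ M) :
    Integrable (fun z => g z * tker n s δ z) :=
  (integrable_tker hn hs hδ).bdd_mul hg.aestronglyMeasurable (ae_of_all _ hb)

theorem ae_ne_zero_Rn (hn : 1 ≤ n) : ∀ᵐ z : Rn n, z ≠ 0 := by
  have := nontrivial_Rn hn
  exact Measure.ae_ne volume 0

/-- Integrals against the truncated kernel are controlled uniformly in the truncation. -/
theorem integral_mul_tker_le (hn : 1 ≤ n) (hs : s ∈ Ioo (0 : ℝ) 1) {δ r M : ℝ}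
    (hr : 0 < r) {g : Rn n → ℝ} (hg : ∀ z, g z ≤ M * min 1 (‖z‖ / r)) (hM : 0 ≤ M) :
    ∫ z, g z * tker n s δ z ≤ M * (r ^ (-s) * kerMass n s) := by
  rw [← integral_min_mul_ker hr, ← integral_const_mul]
  have hint := (integrable_min_mul_ker hn hs hr).const_mul M
  have hpos : ∀ z : Rn n, 0 ≤ M * min 1 (‖z‖ / r) := fun z =>
    mul_nonneg hM (le_min zero_le_one (div_nonneg (norm_nonneg _) hr.le))
  have hle : ∀ᵐ z : Rn n, g z * tker n s δ z ≤ M * (min 1 (‖z‖ / r) * fker n s z) := by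
    filter_upwards [ae_ne_zero_Rn hn] with z hz
    rw [← mul_assoc]
    exact (mul_le_mul_of_nonneg_right (hg z) (tker_nonneg hn hs δ z)).trans
      (mul_le_mul_of_nonneg_left (tker_le_ker hn hs hz) (hpos z))
  by_cases hi : Integrable (fun z => g z * tker n s δ z)
  · exact integral_mono_ae hi hint hle
  · rw [integral_undef hi]
    refine integral_nonneg fun z => ?_
    rw [Pi.zero_apply, ← mul_assoc]
    exact mul_nonneg (hpos z) (ker_nonneg hn hs z)

end Kernel

section Layer

variable {n : ℕ} {s : ℝ}

/-- Nondecreasing odd functions on the line with values in `[-1,1]`. -/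
structure IsOddProfile (f : ℝ → ℝ) : Prop where
  mono : Monotone f
  odd : ∀ x, f (-x) = -f x
  abs_le : ∀ x, |f x| ≤ 1

theorem IsOddProfile.zero {f : ℝ → ℝ} (hf : IsOddProfile f) : f 0 = 0 := by
  have := hf.odd 0
  rw [neg_zero] at this
  linarith

theorem IsOddProfile.nonneg {f : ℝ → ℝ} (hf : IsOddProfile f) {x : ℝ} (hx : 0 ≤ x) :
    0 ≤ f x := hf.zero ▸ hf.mono hx

/-- The planar function `z ↦ f(x + ⟨e,z⟩)` integrated against the truncated kernel. -/
noncomputable def planarAvg (n : ℕ) (s δ : ℝ) (e : Rn n) (f : ℝ → ℝ) (x : ℝ) : ℝ :=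
  ∫ z, f (x + inner ℝ e z) * tker n s δ z

theorem integrable_planar (hn : 1 ≤ n) (hs : s ∈ Ioo (0 : ℝ) 1) {δ M : ℝ} (hδ : 0 < δ)
    (e : Rn n) {f : ℝ → ℝ} (hf : Measurable f) (hM : ∀ x, |f x| ≤ M) (x : ℝ) :
    Integrable (fun z => f (x + inner ℝ e z) * tker n s δ z) :=
  integrable_mul_tker hn hs hδ (hf.comp (by fun_prop)) fun _ => hM _

theorem planarAvg_neg (δ : ℝ) (e : Rn n) {f : ℝ → ℝ} (hodd : ∀ x, f (-x) = -f x) (x : ℝ) :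
    planarAvg n s δ e f (-x) = -planarAvg n s δ e f x := by
  unfold planarAvg
  rw [← integral_neg, ← integral_neg_eq_self]
  congr 1 with z
  rw [inner_neg_right, ← neg_add, hodd, neg_mul, tker_congr_norm (norm_neg z)]

/-- An odd function that is nonnegative on the half-line has nonnegative average there. -/
theorem planarAvg_nonneg (hn : 1 ≤ n) (hs : s ∈ Ioo (0 : ℝ) 1) {δ M : ℝ} (hδ : 0 < δ)
    {e : Rn n} (he : ‖e‖ = 1) {f : ℝ → ℝ} (hf : Measurable f) (hM : ∀ x, |f x| ≤ M)
    (hodd : ∀ x, f (-x) = -f x) (hpos : ∀ x, 0 ≤ x → 0 ≤ f x) {x : ℝ} (hx : 0 ≤ x) :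
    0 ≤ planarAvg n s δ e f x := by
  set F : Rn n → ℝ := fun z => f (x + inner ℝ e z) * tker n s δ z with hF
  have hFint : Integrable F := integrable_planar hn hs hδ e hf hM x
  set R := (ℝ ∙ e).reflection with hR
  set σ : Rn n → Rn n := fun z => -(R z) - (2 * x) • e with hσ
  have hRz : ∀ z, R z = (2 * inner ℝ e z) • e - z := by
    intro z
    rw [hR, Submodule.reflection_singleton_apply, he]
    simp [two_mul, two_smul, add_smul]
  have hee : inner ℝ e e = (1 : ℝ) := by rw [real_inner_self_eq_norm_sq, he]; norm_num
  have hmp : MeasurePreserving σ (volume : Measure (Rn n)) volume :=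
    (measurePreserving_sub_right volume ((2 * x) • e)).comp
      ((Measure.measurePreserving_neg volume).comp R.measurePreserving)
  have hemb : MeasurableEmbedding σ := by
    have h := (R.toHomeomorph.trans (Homeomorph.neg (Rn n))).trans
      (Homeomorph.subRight ((2 * x) • e)) |>.measurableEmbedding
    exact h
  have hinv : ∫ z, F (σ z) = ∫ z, F z := hmp.integral_comp hemb F
  have hσin : ∀ z, x + inner ℝ e (σ z) = -(x + inner ℝ e z) := by
    intro z
    simp only [hσ, hRz, inner_sub_right, inner_neg_right, inner_smul_right, hee]
    ring
  have hσnorm : ∀ z, ‖σ z‖ ^ 2 = ‖z‖ ^ 2 + 4 * x * (x + inner ℝ e z) := by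
    intro z
    have : σ z = z - (2 * (inner ℝ e z + x)) • e := by
      simp only [hσ, hRz]; module
    rw [this, norm_sub_sq_real, norm_smul, inner_smul_right, he, real_inner_comm, norm_eq_abs,
      mul_one, sq_abs]
    ring
  have hsum : 0 ≤ ∫ z, (F z + F (σ z)) := by
    refine integral_nonneg fun z => ?_
    simp only [hF, Pi.zero_apply, hσin, hodd]
    rcases le_total 0 (x + inner ℝ e z) with h | h
    · have h1 : ‖z‖ ≤ ‖σ z‖ := by
        refine le_of_sq_le_sq ?_ (norm_nonneg _)
        rw [hσnorm]; nlinarith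
      nlinarith [tker_anti hn hs hδ h1, hpos _ h]
    · have h1 : ‖σ z‖ ≤ ‖z‖ := by
        refine le_of_sq_le_sq ?_ (norm_nonneg _)
        rw [hσnorm]; nlinarith
      have h2 := hpos (-(x + inner ℝ e z)) (by linarith)
      rw [hodd] at h2
      nlinarith [tker_anti hn hs hδ h1]
  have hFσ : Integrable (fun z => F (σ z)) := hmp.integrable_comp_of_integrable hFint
  rw [integral_add hFint hFσ, hinv] at hsum
  change 0 ≤ ∫ z, F z
  linarith

theorem planarAvg_congr_direction (δ : ℝ) {e e' : Rn n} (h : ‖e‖ = ‖e'‖) (f : ℝ → ℝ) (x : ℝ) :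
    planarAvg n s δ e f x = planarAvg n s δ e' f x := by
  set R := (ℝ ∙ (e - e'))ᗮ.reflection with hR
  have hRe : R e = e' := Submodule.reflection_sub h
  have := R.measurePreserving.integral_comp R.toHomeomorph.measurableEmbedding
    (fun z => f (x + inner ℝ e' z) * tker n s δ z)
  unfold planarAvg
  rw [← this]
  congr 1 with z
  rw [← hRe, R.inner_map_map, tker_congr_norm (R.norm_map z)]

/-- Total mass of the truncated kernel. -/
noncomputable def tkerMass (n : ℕ) (s δ : ℝ) : ℝ := ∫ z : Rn n, tker n s δ z

theorem tkerMass_nonneg (hn : 1 ≤ n) (hs : s ∈ Ioo (0 : ℝ) 1) (δ : ℝ) : 0 ≤ tkerMass n s δ :=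
  integral_nonneg (tker_nonneg hn hs δ)

theorem planarAvg_mono (hn : 1 ≤ n) (hs : s ∈ Ioo (0 : ℝ) 1) {δ : ℝ} (hδ : 0 < δ)
    (e : Rn n) {f : ℝ → ℝ} (hf : IsOddProfile f) : Monotone (planarAvg n s δ e f) := by
  intro x y hxy
  refine integral_mono (integrable_planar hn hs hδ e hf.mono.measurable hf.abs_le x)
    (integrable_planar hn hs hδ e hf.mono.measurable hf.abs_le y) fun z => ?_
  exact mul_le_mul_of_nonneg_right (hf.mono (by linarith)) (tker_nonneg hn hs δ z)

theorem abs_planarAvg_le (hn : 1 ≤ n) (hs : s ∈ Ioo (0 : ℝ) 1) {δ : ℝ} (hδ : 0 < δ)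
    (e : Rn n) {f : ℝ → ℝ} (hf : IsOddProfile f) (x : ℝ) :
    |planarAvg n s δ e f x| ≤ tkerMass n s δ := by
  unfold planarAvg tkerMass
  rw [← norm_eq_abs]
  refine norm_integral_le_of_norm_le (integrable_tker hn hs hδ) (ae_of_all _ fun z => ?_)
  rw [norm_mul, norm_of_nonneg (tker_nonneg hn hs δ z), norm_eq_abs]
  exact mul_le_of_le_one_left (tker_nonneg hn hs δ z) (hf.abs_le _)

theorem integral_sub_planar (hn : 1 ≤ n) (hs : s ∈ Ioo (0 : ℝ) 1) {δ : ℝ} (hδ : 0 < δ)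
    (e : Rn n) {f : ℝ → ℝ} (hf : IsOddProfile f) (c x : ℝ) :
    ∫ z, (c - f (x + inner ℝ e z)) * tker n s δ z
      = c * tkerMass n s δ - planarAvg n s δ e f x := by
  simp_rw [sub_mul]
  rw [integral_sub ((integrable_tker hn hs hδ).const_mul c)
    (integrable_planar hn hs hδ e hf.mono.measurable hf.abs_le x), integral_const_mul]
  rfl

/-- The order-preserving map whose fixed points are planar solutions of the truncated equation. -/
noncomputable def layerMap (n : ℕ) (s δ lam : ℝ) (e : Rn n) (f : ℝ → ℝ) (x : ℝ) : ℝ :=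
  (planarAvg n s δ e f x + lam * (3 * f x - f x ^ 3)) / (tkerMass n s δ + 2 * lam)

theorem three_mul_sub_cube_mono {a b : ℝ} (ha : |a| ≤ 1) (hb : |b| ≤ 1) (h : a ≤ b) :
    3 * a - a ^ 3 ≤ 3 * b - b ^ 3 := by
  obtain ⟨a1, a2⟩ := abs_le.1 ha
  obtain ⟨b1, b2⟩ := abs_le.1 hb
  have : a ^ 2 + a * b + b ^ 2 ≤ 3 := by nlinarith
  nlinarith [mul_nonneg (sub_nonneg.2 h) (sub_nonneg.2 this)]

theorem IsOddProfile.layerMap (hn : 1 ≤ n) (hs : s ∈ Ioo (0 : ℝ) 1) {δ lam : ℝ} (hδ : 0 < δ)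
    (hlam : 0 < lam) (e : Rn n) {f : ℝ → ℝ} (hf : IsOddProfile f) :
    IsOddProfile (layerMap n s δ lam e f) where
  mono x y hxy := by
    have := tkerMass_nonneg hn hs δ
    refine div_le_div_of_nonneg_right ?_ (by positivity)
    exact add_le_add (planarAvg_mono hn hs hδ e hf hxy) (mul_le_mul_of_nonneg_left
      (three_mul_sub_cube_mono (hf.abs_le _) (hf.abs_le _) (hf.mono hxy)) hlam.le)
  odd x := by
    unfold _root_.layerMap
    rw [planarAvg_neg δ e hf.odd, hf.odd]
    ring
  abs_le x := by
    have := tkerMass_nonneg hn hs δ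
    unfold _root_.layerMap
    rw [abs_div, abs_of_pos (a := tkerMass n s δ + 2 * lam) (by positivity),
      div_le_one (by positivity)]
    refine (abs_add_le _ _).trans (add_le_add (abs_planarAvg_le hn hs hδ e hf x) ?_)
    rw [abs_mul, abs_of_pos hlam, mul_comm]
    refine mul_le_mul_of_nonneg_right ?_ hlam.le
    obtain ⟨a1, a2⟩ := _root_.abs_le.1 (hf.abs_le x)
    have h1 := three_mul_sub_cube_mono (hf.abs_le x) (b := 1) (by simp) a2
    have h2 := three_mul_sub_cube_mono (a := -1) (by simp) (hf.abs_le x) a1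
    rw [_root_.abs_le]
    constructor <;> linarith

theorem layerMap_mono (hn : 1 ≤ n) (hs : s ∈ Ioo (0 : ℝ) 1) {δ lam : ℝ} (hδ : 0 < δ)
    (hlam : 0 < lam) {e : Rn n} (he : ‖e‖ = 1) {f g : ℝ → ℝ} (hf : IsOddProfile f)
    (hg : IsOddProfile g) (hfg : ∀ x, 0 ≤ x → f x ≤ g x) {x : ℝ} (hx : 0 ≤ x) :
    layerMap n s δ lam e f x ≤ layerMap n s δ lam e g x := by
  have hN := tkerMass_nonneg hn hs δ
  refine div_le_div_of_nonneg_right ?_ (by positivity)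
  refine add_le_add ?_ (mul_le_mul_of_nonneg_left
      (three_mul_sub_cube_mono (hf.abs_le _) (hg.abs_le _) (hfg x hx)) hlam.le)
  have h := planarAvg_nonneg hn hs hδ he (f := fun x => g x - f x) (M := 2)
    (hg.mono.measurable.sub hf.mono.measurable)
    (fun x => by
      have h1 := abs_le.1 (hf.abs_le x)
      have h2 := abs_le.1 (hg.abs_le x)
      rw [abs_le]; constructor <;> linarith [h1.1, h1.2, h2.1, h2.2])
    (fun x => by rw [hf.odd, hg.odd]; ring) (fun x hx => sub_nonneg.2 (hfg x hx)) hx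
  unfold planarAvg at h ⊢
  simp_rw [sub_mul] at h
  rw [integral_sub (integrable_planar hn hs hδ e hg.mono.measurable hg.abs_le x)
    (integrable_planar hn hs hδ e hf.mono.measurable hf.abs_le x)] at h
  linarith

/-- The Knaster–Tarski fixed point: the largest profile lying below its image. -/
theorem exists_fixedPoint_layerMap (hn : 1 ≤ n) (hs : s ∈ Ioo (0 : ℝ) 1) {δ lam : ℝ}
    (hδ : 0 < δ) (hlam : 0 < lam) {e : Rn n} (he : ‖e‖ = 1) :
    ∃ φ : ℝ → ℝ, IsOddProfile φ ∧ (∀ x, layerMap n s δ lam e φ x = φ x) ∧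
      ∀ f, IsOddProfile f → (∀ x, 0 ≤ x → f x ≤ layerMap n s δ lam e f x) →
        ∀ x, 0 ≤ x → f x ≤ φ x := by
  set S : Set (ℝ → ℝ) :=
    {f | IsOddProfile f ∧ ∀ x, 0 ≤ x → f x ≤ layerMap n s δ lam e f x} with hS
  have h0 : (fun _ => 0 : ℝ → ℝ) ∈ S := by
    refine ⟨⟨monotone_const, by simp, by simp⟩, fun x _ => ?_⟩
    simp [layerMap, planarAvg]
  have hne : Nonempty S := ⟨⟨_, h0⟩⟩
  set P : ℝ → ℝ := fun x => ⨆ f : S, f.1 x with hP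
  have hbdd : ∀ x, BddAbove (range fun f : S => f.1 x) := by
    intro x
    refine ⟨1, ?_⟩
    rintro _ ⟨f, rfl⟩
    exact (abs_le.1 (f.2.1.abs_le x)).2
  have hleP : ∀ f ∈ S, ∀ x, f x ≤ P x := fun f hf x => le_ciSup (hbdd x) ⟨f, hf⟩
  have hP1 : ∀ x, P x ≤ 1 := fun x => ciSup_le fun f => (abs_le.1 (f.2.1.abs_le x)).2
  have hP0 : ∀ x, 0 ≤ P x := fun x => hleP _ h0 x
  have hPmono : Monotone P := fun x y hxy => ciSup_mono (hbdd y) fun f => f.2.1.mono hxy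
  have hPz : P 0 = 0 := le_antisymm (ciSup_le fun f => f.2.1.zero.le) (hP0 0)
  set φ : ℝ → ℝ := fun x => if 0 ≤ x then P x else -P (-x) with hφ
  have hφpos : ∀ x, 0 ≤ x → φ x = P x := fun x hx => if_pos hx
  have hφprof : IsOddProfile φ := by
    refine ⟨fun x y hxy => ?_, fun x => ?_, fun x => ?_⟩
    · simp only [hφ]
      split_ifs with h1 h2 h2
      · exact hPmono hxy
      · linarith
      · linarith [hP0 (-x), hP0 y]
      · exact neg_le_neg (hPmono (by linarith))
    · simp only [hφ]
      rcases lt_trichotomy x 0 with h | h | h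
      · rw [if_pos (by linarith), if_neg (by linarith)]; ring
      · simp [h, hPz]
      · rw [if_neg (by linarith), if_pos (by linarith), neg_neg]
    · simp only [hφ]
      rw [abs_le]
      split_ifs
      · exact ⟨by linarith [hP0 x], hP1 x⟩
      · exact ⟨by linarith [hP1 (-x)], by linarith [hP0 (-x)]⟩
  have hle : ∀ x, 0 ≤ x → φ x ≤ layerMap n s δ lam e φ x := by
    intro x hx
    rw [hφpos x hx]
    refine ciSup_le fun f => (f.2.2 x hx).trans ?_
    exact layerMap_mono hn hs hδ hlam he f.2.1 hφprof
      (fun y hy => (hleP f.1 f.2 y).trans (hφpos y hy).ge) hx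
  have hprof' := hφprof.layerMap hn hs hδ hlam e
  have hge : ∀ x, 0 ≤ x → layerMap n s δ lam e φ x ≤ φ x := by
    intro x hx
    rw [hφpos x hx]
    exact hleP _ ⟨hprof', fun y hy => layerMap_mono hn hs hδ hlam he hφprof hprof' hle hy⟩ x
  have hfix : ∀ x, 0 ≤ x → layerMap n s δ lam e φ x = φ x := fun x hx =>
    le_antisymm (hge x hx) (hle x hx)
  refine ⟨φ, hφprof, fun x => ?_, fun f h1 h2 x hx => ?_⟩
  · rcases le_total 0 x with h | h
    · exact hfix x h
    · have := hfix (-x) (by linarith)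
      rw [hprof'.odd, hφprof.odd] at this
      linarith
  · rw [hφpos x hx]
    exact hleP f ⟨h1, h2⟩ x

end Layer

section LayerProperties

variable {n : ℕ} {s : ℝ}

/-- Truncation of the identity to `[-1,1]`. -/
noncomputable def clampUnit (x : ℝ) : ℝ := max (-1) (min 1 x)

theorem isOddProfile_clampUnit : IsOddProfile clampUnit where
  mono x y h := max_le_max_left _ (min_le_min_left _ h)
  odd x := by
    unfold clampUnit
    rcases le_total 1 x with h | h <;> rcases le_total (-1) x with h' | h' <;>
      simp only [max_def, min_def] <;> split_ifs <;> linarith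
  abs_le x := abs_le.2 ⟨le_max_left _ _, max_le (by norm_num) (min_le_left _ _)⟩

theorem clampUnit_second_difference_le {x : ℝ} (hx : 0 ≤ x) (t : ℝ) :
    2 * clampUnit x - clampUnit (x + t) - clampUnit (x - t)
      ≤ 2 * clampUnit x * min 1 (2 * |t|) := by
  have hc := isOddProfile_clampUnit
  wlog ht : 0 ≤ t generalizing t
  · have := this (-t) (by linarith)
    rw [abs_neg, sub_neg_eq_add, ← sub_eq_add_neg] at this
    linarith
  rw [abs_of_nonneg ht]
  have hx0 := hc.nonneg hx
  have h1 : 0 ≤ clampUnit (x + t) + clampUnit (x - t) := by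
    have := hc.mono (show -(x - t) ≤ x + t by linarith)
    rw [hc.odd] at this
    linarith
  have hlow : ∀ y, y ≤ 1 → y ≤ clampUnit y := fun y hy =>
    (le_min hy le_rfl).trans (le_max_right _ _)
  have hone : ∀ y, 1 ≤ y → clampUnit y = 1 := fun y hy => by
    simp [clampUnit, min_eq_left hy]
  have hself : ∀ y, 0 ≤ y → y ≤ 1 → clampUnit y = y := fun y h0 h1 => by
    rw [clampUnit, min_eq_right h1, max_eq_right (by linarith)]
  rw [mul_min_of_nonneg _ _ (by linarith : (0 : ℝ) ≤ 2 * clampUnit x)]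
  refine le_min (by linarith) ?_
  rcases le_total 1 x with hx1 | hx1
  · rw [hone x hx1, hone (x + t) (by linarith)]
    rcases le_total 1 (x - t) with h | h
    · rw [hone _ h]; linarith
    · linarith [hlow _ h]
  · rw [hself x hx hx1]
    have hl := hlow (x - t) (by linarith)
    rcases le_total 1 (x + t) with h | h
    · rw [hone _ h] at h1 ⊢
      rcases le_total (1 / 2) t with h2 | h2 <;> nlinarith
    · rw [hself (x + t) (by linarith) h]
      nlinarith

theorem planarAvg_comp_neg (δ : ℝ) (e : Rn n) (f : ℝ → ℝ) (x : ℝ) :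
    planarAvg n s δ e f x = ∫ z, f (x - inner ℝ e z) * tker n s δ z := by
  unfold planarAvg
  rw [← integral_neg_eq_self]
  congr 1 with z
  rw [inner_neg_right, tker_congr_norm (norm_neg z), ← sub_eq_add_neg]

/-- Rescaled truncations are odd subsolutions of the layer equation. -/
theorem clamp_le_layerMap (hn : 1 ≤ n) (hs : s ∈ Ioo (0 : ℝ) 1) {δ lam L θ : ℝ} (hδ : 0 < δ)
    (hlam : 0 < lam) (hL : 0 < L) {e : Rn n} (he : ‖e‖ = 1) (hθ : θ ∈ Icc (0 : ℝ) 1)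
    (hθL : 2 * kerMass n s * L ^ (-s) ≤ lam * (1 - θ)) {x : ℝ} (hx : 0 ≤ x) :
    θ * clampUnit (x / L) ≤ layerMap n s δ lam e (fun x => θ * clampUnit (x / L)) x := by
  obtain ⟨hθ0, hθ1⟩ := hθ
  have hN := tkerMass_nonneg hn hs δ
  set f : ℝ → ℝ := fun x => θ * clampUnit (x / L) with hf
  have hcm := isOddProfile_clampUnit
  have hfm : Measurable f := by
    have := hcm.mono.measurable
    exact (this.comp (by fun_prop)).const_mul _
  have hfb : ∀ x, |f x| ≤ 1 := fun x => by
    rw [hf]; simp only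
    rw [abs_mul, abs_of_nonneg hθ0]
    exact mul_le_one₀ hθ1 (abs_nonneg _) (hcm.abs_le _)
  set c := clampUnit (x / L) with hc
  have hc0 : 0 ≤ c := hcm.nonneg (by positivity)
  have hc1 : c ≤ 1 := (abs_le.1 (hcm.abs_le _)).2
  have hkey : ∫ z, (2 * f x - f (x + inner ℝ e z) - f (x - inner ℝ e z)) * tker n s δ z
      ≤ 4 * θ * c * (L ^ (-s) * kerMass n s) := by
    refine integral_mul_tker_le hn hs hL (fun z => ?_) (by positivity)
    have h := clampUnit_second_difference_le (x := x / L) (by positivity) (inner ℝ e z / L)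
    rw [← add_div, ← sub_div] at h
    have hle : |inner ℝ e z / L| ≤ ‖z‖ / L := by
      rw [abs_div, abs_of_pos hL]
      have := abs_real_inner_le_norm e z
      rw [he, one_mul] at this
      gcongr
    have hmin : min 1 (2 * |inner ℝ e z / L|) ≤ 2 * min 1 (‖z‖ / L) := by
      rw [mul_min_of_nonneg _ _ zero_le_two]
      exact min_le_min (by norm_num) (by linarith)
    have h2 : 2 * c * min 1 (2 * |inner ℝ e z / L|) ≤ 2 * c * (2 * min 1 (‖z‖ / L)) :=
      mul_le_mul_of_nonneg_left hmin (by positivity)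
    have h3 := mul_le_mul_of_nonneg_left (h.trans h2) hθ0
    simp only [hf]
    linarith
  have hi1 := integrable_planar hn hs hδ e hfm hfb x
  have hi2 : Integrable (fun z => f (x - inner ℝ e z) * tker n s δ z) :=
    integrable_mul_tker hn hs hδ (hfm.comp (by fun_prop)) fun _ => hfb _
  have hi0 := (integrable_tker hn hs hδ).const_mul (2 * f x)
  have heq : ∫ z, (2 * f x - f (x + inner ℝ e z) - f (x - inner ℝ e z)) * tker n s δ z
      = 2 * f x * tkerMass n s δ - 2 * planarAvg n s δ e f x := by
    simp_rw [sub_mul]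
    have hi01 : Integrable fun z => 2 * f x * tker n s δ z
        - f (x + inner ℝ e z) * tker n s δ z := hi0.sub hi1
    rw [integral_sub hi01 hi2, integral_sub hi0 hi1, integral_const_mul,
      ← planarAvg_comp_neg]
    change _ - planarAvg n s δ e f x - _ = _
    rw [tkerMass]; ring
  rw [heq] at hkey
  have hfx : f x = θ * c := rfl
  rw [← hfx, layerMap, le_div_iff₀ (by positivity)]
  have h1 : 2 * θ * c * (L ^ (-s) * kerMass n s) ≤ θ * c * (lam * (1 - θ)) := by
    have := mul_le_mul_of_nonneg_left hθL (mul_nonneg hθ0 hc0)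
    linarith
  have h2 : (θ * c) ^ 2 ≤ θ := by
    have : θ * c ≤ θ := mul_le_of_le_one_right hθ0 hc1
    nlinarith [mul_nonneg hθ0 hc0]
  have h3 : lam * (θ * c) * (θ * c) ^ 2 ≤ lam * (θ * c) * θ :=
    mul_le_mul_of_nonneg_left h2 (by positivity)
  rw [hfx] at hkey ⊢
  nlinarith

/-- Volume of the unit ball. -/
noncomputable def unitVol (n : ℕ) : ℝ := volume.real (ball (0 : Rn n) 1)

theorem unitVol_pos : 0 < unitVol n :=
  ENNReal.toReal_pos (measure_ball_pos _ _ one_pos).ne' measure_ball_lt_top.ne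

theorem volume_real_ball_Rn (x : Rn n) {r : ℝ} (hr : 0 < r) :
    volume.real (ball x r) = r ^ n * unitVol n := by
  rw [measureReal_def, Measure.addHaar_ball_of_pos _ _ hr, ENNReal.toReal_mul,
    ENNReal.toReal_ofReal (by positivity), finrank_euclideanSpace_fin]
  rfl

theorem le_tkerMass (hn : 1 ≤ n) (hs : s ∈ Ioo (0 : ℝ) 1) {δ : ℝ} (hδ : 0 < δ) :
    alphaC n s * unitVol n * δ ^ (-s) ≤ tkerMass n s δ := by
  have h1 : ∫ _ in ball (0 : Rn n) δ, alphaC n s * δ ^ (-((n : ℝ) + s))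
      ≤ ∫ z in ball (0 : Rn n) δ, tker n s δ z := by
    refine setIntegral_mono_on (integrableOn_const measure_ball_lt_top.ne)
      (integrable_tker hn hs hδ).integrableOn measurableSet_ball fun z hz => ?_
    exact le_tker hn hs hδ (by simpa using (mem_ball_zero_iff.1 hz).le) le_rfl
  have h2 := setIntegral_le_integral (s := ball (0 : Rn n) δ) (integrable_tker hn hs hδ)
    (ae_of_all _ (tker_nonneg hn hs δ))
  refine le_trans (le_of_eq ?_) (h1.trans h2)
  rw [setIntegral_const, volume_real_ball_Rn _ hδ, smul_eq_mul,
    show -s = -((n : ℝ) + s) + n by ring, rpow_add hδ, rpow_natCast]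
  ring

/-- Shifting a function with values in `[-1,1]` changes its ball integral by a shell volume. -/
theorem setIntegral_shift_sub_le {f : Rn n → ℝ} (hf : Measurable f) (hb : ∀ z, |f z| ≤ 1)
    {r h : ℝ} (hr : 0 < r) (hh : 0 ≤ h) {v : Rn n} (hv : ‖v‖ ≤ h) :
    ∫ w in ball 0 r, (f (w + v) - f w) ≤ 2 * ((r + h) ^ n - r ^ n) * unitVol n := by
  have hint : ∀ (x : Rn n) (ρ : ℝ), IntegrableOn f (ball x ρ) := fun x ρ =>
    Measure.integrableOn_of_bounded (M := 1) measure_ball_lt_top.ne hf.aestronglyMeasurable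
      (ae_of_all _ hb)
  have hintv : IntegrableOn (fun w => f (w + v)) (ball 0 r) :=
    Measure.integrableOn_of_bounded (M := 1) measure_ball_lt_top.ne
      (hf.comp (by fun_prop)).aestronglyMeasurable (ae_of_all _ fun _ => hb _)
  have hshift : ∫ w in ball 0 r, f (w + v) = ∫ w in ball v r, f w := by
    have := (measurePreserving_add_right (volume : Measure (Rn n)) v).setIntegral_preimage_emb
      (measurableEmbedding_addRight v) f (ball v r)
    rw [← this]
    congr 2
    ext w; simp [mem_ball, dist_eq_norm]
  rw [integral_sub hintv (hint 0 r), hshift]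
  have hsub1 : ball v r ⊆ ball (0 : Rn n) (r + h) :=
    ball_subset_ball' (by rw [dist_zero_right]; linarith)
  have hsub2 : ball (0 : Rn n) r ⊆ ball (0 : Rn n) (r + h) := ball_subset_ball (by linarith)
  have hplus : ∀ (x : Rn n) (ρ : ℝ), 0 < ρ →
      ∫ w in ball x ρ, (f w + 1) = (∫ w in ball x ρ, f w) + ρ ^ n * unitVol n := by
    intro x ρ hρ
    rw [integral_add (hint x ρ) (integrableOn_const measure_ball_lt_top.ne),
      setIntegral_const, volume_real_ball_Rn x hρ]
    simp
  have hint1 : ∀ (x : Rn n) (ρ : ℝ), IntegrableOn (fun w => f w + 1) (ball x ρ) := fun x ρ =>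
    (hint x ρ).add (integrableOn_const measure_ball_lt_top.ne)
  have h1 : ∫ w in ball v r, (f w + 1) ≤ ∫ w in ball 0 (r + h), (f w + 1) :=
    setIntegral_mono_set (hint1 _ _)
      (ae_of_all _ fun w => by have := (abs_le.1 (hb w)).1; simp; linarith)
      hsub1.eventuallyLE
  have h2 : ∫ w in ball 0 (r + h) \ ball 0 r, (f w + 1)
      ≤ ∫ _ in ball (0 : Rn n) (r + h) \ ball 0 r, (2 : ℝ) := by
    refine setIntegral_mono ((hint1 _ _).mono_set sdiff_subset)
      (integrableOn_const ((measure_mono sdiff_subset).trans_lt measure_ball_lt_top).ne)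
      fun w => ?_
    have := (abs_le.1 (hb w)).2
    simp only; linarith
  rw [setIntegral_const, measureReal_sdiff hsub2 measurableSet_ball,
    volume_real_ball_Rn _ hr, volume_real_ball_Rn _ (by linarith), smul_eq_mul] at h2
  have h3 := setIntegral_sdiff measurableSet_ball (hint1 0 (r + h)) hsub2
  rw [h3, hplus 0 r hr] at h2
  rw [hplus v r hr] at h1
  linarith

theorem setIntegral_compl_ball_mul_tker_le (hn : 1 ≤ n) (hs : s ∈ Ioo (0 : ℝ) 1) {δ r M : ℝ}
    (hr : 0 < r) (hM : 0 ≤ M) {G : Rn n → ℝ} (hG : ∀ z, G z ≤ M) :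
    ∫ z in (ball (0 : Rn n) r)ᶜ, G z * tker n s δ z ≤ M * (r ^ (-s) * kerMass n s) := by
  rw [← integral_indicator measurableSet_ball.compl]
  have : ∀ z, (ball (0 : Rn n) r)ᶜ.indicator (fun z => G z * tker n s δ z) z
      = (ball (0 : Rn n) r)ᶜ.indicator G z * tker n s δ z := fun z => by
    by_cases hz : z ∈ (ball (0 : Rn n) r)ᶜ <;> simp [indicator, hz]
  simp_rw [this]
  refine integral_mul_tker_le hn hs hr (fun z => ?_) hM
  by_cases hz : z ∈ (ball (0 : Rn n) r)ᶜ
  · rw [indicator_of_mem hz]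
    rw [mem_compl_iff, mem_ball_zero_iff, not_lt] at hz
    rw [min_eq_left ((one_le_div hr).2 hz)]
    linarith [hG z]
  · rw [indicator_of_notMem hz]
    have := norm_nonneg z
    positivity

theorem planarAvg_sub_le (hn : 1 ≤ n) (hs : s ∈ Ioo (0 : ℝ) 1) {δ r h : ℝ} (hδ : 0 < δ)
    (hr : 0 < r) (hh : 0 ≤ h) {e : Rn n} (he : ‖e‖ = 1) {f : ℝ → ℝ} (hf : IsOddProfile f)
    (x : ℝ) :
    planarAvg n s δ e f (x + h) - planarAvg n s δ e f x
      ≤ alphaC n s * δ ^ (-((n : ℝ) + s)) * (2 * ((r + h) ^ n - r ^ n) * unitVol n)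
        + 2 * (r ^ (-s) * kerMass n s) := by
  set G : Rn n → ℝ := fun z => f (x + h + inner ℝ e z) - f (x + inner ℝ e z) with hG
  have hfm := hf.mono.measurable
  have hGm : Measurable G := (hfm.comp (by fun_prop)).sub (hfm.comp (by fun_prop))
  have hG0 : ∀ z, 0 ≤ G z := fun z => sub_nonneg.2 (hf.mono (by linarith))
  have hG2 : ∀ z, G z ≤ 2 := fun z => by
    have h1 := abs_le.1 (hf.abs_le (x + h + inner ℝ e z))
    have h2 := abs_le.1 (hf.abs_le (x + inner ℝ e z))
    simp only [hG]; linarith [h1.2, h2.1]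
  have hGint : Integrable (fun z => G z * tker n s δ z) :=
    integrable_mul_tker hn hs hδ hGm fun z => by rw [abs_of_nonneg (hG0 z)]; exact hG2 z
  have heq : planarAvg n s δ e f (x + h) - planarAvg n s δ e f x
      = ∫ z, G z * tker n s δ z := by
    unfold planarAvg
    rw [← integral_sub (integrable_planar hn hs hδ e hfm hf.abs_le _)
      (integrable_planar hn hs hδ e hfm hf.abs_le _)]
    simp only [hG, sub_mul]
  rw [heq, ← integral_add_compl (measurableSet_ball (x := (0 : Rn n)) (ε := r)) hGint]
  refine add_le_add ?_ ?_
  · have hbound := setIntegral_shift_sub_le (f := fun w => f (x + inner ℝ e w))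
      (hfm.comp (by fun_prop)) (fun z => hf.abs_le _) hr hh (v := h • e)
      (by rw [norm_smul, he, mul_one, norm_of_nonneg hh])
    have hC : 0 ≤ alphaC n s * δ ^ (-((n : ℝ) + s)) :=
      mul_nonneg (alphaC_pos hn hs).le (rpow_nonneg hδ.le _)
    refine le_trans ?_ (mul_le_mul_of_nonneg_left hbound hC)
    rw [← integral_const_mul]
    refine setIntegral_mono_on hGint.integrableOn
      (Measure.integrableOn_of_bounded (M := alphaC n s * δ ^ (-((n : ℝ) + s)) * 2)
        measure_ball_lt_top.ne ?_ (ae_of_all _ fun w => ?_)) measurableSet_ball fun w _ => ?_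
    · exact (((hfm.comp (by fun_prop)).sub (hfm.comp (by fun_prop))).const_mul
        _).aestronglyMeasurable
    · rw [norm_mul, norm_of_nonneg hC, norm_eq_abs]
      refine mul_le_mul_of_nonneg_left ?_ hC
      refine (abs_sub _ _).trans ?_
      linarith [hf.abs_le (x + inner ℝ e (w + h • e)), hf.abs_le (x + inner ℝ e w)]
    · have : inner ℝ e (w + h • e) = inner ℝ e w + h := by
        rw [inner_add_right, inner_smul_right, real_inner_self_eq_norm_sq, he]; ring
      rw [this, mul_comm, show x + (inner ℝ e w + h) = x + h + inner ℝ e w by ring]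
      exact mul_le_mul_of_nonneg_right (tker_le hn hs hδ (le_max_right _ _)) (hG0 w)
  · exact setIntegral_compl_ball_mul_tker_le hn hs hr zero_le_two hG2

end LayerProperties

section LayerExistence

variable {n : ℕ} {s : ℝ}

theorem exists_unit_Rn (hn : 1 ≤ n) : ∃ e : Rn n, ‖e‖ = 1 := by
  have := nontrivial_Rn hn
  exact exists_norm_eq (Rn n) zero_le_one

/-- A continuous planar layer for the truncated equation, with algebraic decay to `±1`. -/
theorem exists_layer (hn : 1 ≤ n) (hs : s ∈ Ioo (0 : ℝ) 1) {δ lam : ℝ} (hδ : 0 < δ)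
    (hlam : 0 < lam) (hlt : lam < tkerMass n s δ) :
    ∃ φ : ℝ → ℝ, IsOddProfile φ ∧ Continuous φ ∧
      (∀ e : Rn n, ‖e‖ = 1 → ∀ x,
        ∫ z, (φ x - φ (x + inner ℝ e z)) * tker n s δ z = lam * (φ x - φ x ^ 3)) ∧
      ∀ L, 0 < L → 1 - 2 * kerMass n s * L ^ (-s) / lam ≤ φ L := by
  obtain ⟨e, he⟩ := exists_unit_Rn hn
  obtain ⟨φ, hφ, hfix, hmax⟩ := exists_fixedPoint_layerMap hn hs hδ hlam he
  have hN := tkerMass_nonneg hn hs δ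
  have hfix' : ∀ x, planarAvg n s δ e φ x
      = (tkerMass n s δ - lam) * φ x + lam * φ x ^ 3 := fun x => by
    have := hfix x
    rw [layerMap, div_eq_iff (by positivity)] at this
    linarith
  refine ⟨φ, hφ, ?_, fun e' he' x => ?_, fun L hL => ?_⟩
  · have hgap : 0 < tkerMass n s δ - lam := sub_pos.2 hlt
    refine Metric.continuous_iff.2 fun x η hη => ?_
    have hlim : Tendsto (fun r : ℝ => 2 * (r ^ (-s) * kerMass n s)) atTop (𝓝 0) := by
      simpa using ((tendsto_rpow_neg_atTop hs.1).mul_const (kerMass n s)).const_mul 2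
    obtain ⟨r, hr, hr0⟩ := ((hlim.eventually_lt_const
      (show 0 < (tkerMass n s δ - lam) * η / 2 by positivity)).and (eventually_gt_atTop 0)).exists
    have hcont : Tendsto (fun h : ℝ => alphaC n s * δ ^ (-((n : ℝ) + s)) *
        (2 * ((r + h) ^ n - r ^ n) * unitVol n)) (𝓝 0) (𝓝 0) := by
      have : Continuous fun h : ℝ => alphaC n s * δ ^ (-((n : ℝ) + s)) *
        (2 * ((r + h) ^ n - r ^ n) * unitVol n) := by fun_prop
      simpa using this.tendsto 0
    obtain ⟨ν, hν, hsmall⟩ := Metric.eventually_nhds_iff.1 (hcont.eventually_lt_const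
      (show 0 < (tkerMass n s δ - lam) * η / 2 by positivity))
    have hmod : ∀ a b, a ≤ b → b - a < ν → φ b - φ a < η := fun a b hab hlt => by
      have h1 := planarAvg_sub_le hn hs hδ hr0 (sub_nonneg.2 hab) he hφ a
      have h2 := hsmall (y := b - a) (by
        rw [dist_zero_right, norm_of_nonneg (sub_nonneg.2 hab)]; exact hlt)
      rw [add_sub_cancel, hfix', hfix'] at h1
      have h3 : φ a ^ 3 ≤ φ b ^ 3 := Odd.pow_le_pow (by decide) |>.2 (hφ.mono hab)
      have h4 := mul_le_mul_of_nonneg_left h3 hlam.le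
      refine lt_of_mul_lt_mul_left (a := tkerMass n s δ - lam) ?_ hgap.le
      linarith
    refine ⟨ν, hν, fun y hy => ?_⟩
    rw [dist_eq_norm, norm_eq_abs] at hy ⊢
    obtain ⟨hy1, hy2⟩ := abs_lt.1 hy
    rcases le_total x y with h | h
    · rw [abs_of_nonneg (sub_nonneg.2 (hφ.mono h))]
      exact hmod x y h hy2
    · rw [abs_sub_comm, abs_of_nonneg (sub_nonneg.2 (hφ.mono h))]
      exact hmod y x h (by linarith)
  · rw [integral_sub_planar hn hs hδ e' hφ, planarAvg_congr_direction δ (he'.trans he.symm) φ x,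
      hfix']
    ring
  · set θ := 1 - 2 * kerMass n s * L ^ (-s) / lam with hθ
    have hc := kerMass_nonneg hn hs
    have hL' := rpow_nonneg hL.le (-s)
    rcases lt_or_ge θ 0 with h | h
    · exact h.le.trans (hφ.nonneg hL.le)
    have hcm := isOddProfile_clampUnit
    have hθ1 : θ ≤ 1 := sub_le_self _ (by positivity)
    have := hmax (fun x => θ * clampUnit (x / L))
      ⟨fun x y hxy => mul_le_mul_of_nonneg_left
          (hcm.mono (div_le_div_of_nonneg_right hxy hL.le)) h,
        fun x => by rw [neg_div, hcm.odd]; ring,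
        fun x => by
          rw [abs_mul, abs_of_nonneg h]
          exact mul_le_one₀ hθ1 (abs_nonneg _) (hcm.abs_le _)⟩
      (fun x hx => clamp_le_layerMap hn hs hδ hlam hL he ⟨h, hθ1⟩
        (by rw [hθ]; field_simp; linarith) hx) L hL.le
    rw [div_self hL.ne'] at this
    simpa [clampUnit] using this

end LayerExistence

section Curvature

variable {n : ℕ} {s : ℝ}

theorem add_pow_sub_pow_le {r x : ℝ} (hr : 0 ≤ r) (hx0 : 0 ≤ x) (hx1 : x ≤ 1) (n : ℕ) :
    (r + r * x) ^ n - r ^ n ≤ r ^ n * (2 ^ n * x) := by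
  have h : ∀ n : ℕ, (1 + x) ^ n ≤ 1 + (2 ^ n - 1) * x := fun n => by
    induction n with
    | zero => simp
    | succ k ih =>
      have h2 : (1 : ℝ) ≤ 2 ^ k := one_le_pow₀ one_le_two
      have h3 : (2 ^ k - 1) * (x * x) ≤ (2 ^ k - 1) * x :=
        mul_le_mul_of_nonneg_left (by nlinarith) (by linarith)
      rw [pow_succ, pow_succ]
      nlinarith
  have := mul_le_mul_of_nonneg_left (h n) (pow_nonneg hr n)
  rw [← mul_pow] at this
  rw [show r + r * x = r * (1 + x) by ring]
  nlinarith [mul_nonneg (pow_nonneg hr n) hx0]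

/-- Summation of dyadic increments of geometric size. -/
theorem dyadic_sum_le {A : ℝ → ℝ} {ρ B a : ℝ} (hρ : 0 < ρ) (hB : 0 ≤ B) (ha : 0 < a)
    (hA : ∀ r, 0 < r → r ≤ ρ → A r ≤ A (r / 2) + B * r ^ a)
    (hlim : Tendsto (fun N : ℕ => A (ρ / 2 ^ N)) atTop (𝓝 0)) :
    A ρ ≤ B * ρ ^ a / (1 - 2 ^ (-a)) := by
  set q : ℝ := 2 ^ (-a) with hq
  have hq0 : 0 < q := rpow_pos_of_pos two_pos _
  have hq1 : q < 1 := rpow_lt_one_of_one_lt_of_neg one_lt_two (neg_neg_of_pos ha)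
  set K := B * ρ ^ a / (1 - q) with hK
  have hK0 : 0 ≤ K := by
    have := rpow_nonneg hρ.le a
    exact div_nonneg (by positivity) (by linarith)
  have hKq : B * ρ ^ a = K * (1 - q) := by
    rw [hK, div_mul_cancel₀]
    linarith
  have hind : ∀ N : ℕ, A ρ + K * q ^ N ≤ A (ρ / 2 ^ N) + K := fun N => by
    induction N with
    | zero => simp
    | succ k ih =>
      have h := hA (ρ / 2 ^ k) (by positivity) (div_le_self hρ.le (one_le_pow₀ one_le_two))
      have hpow : (ρ / 2 ^ k) ^ a = ρ ^ a * q ^ k := by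
        rw [div_rpow hρ.le (by positivity), hq, ← rpow_natCast, ← rpow_natCast,
          ← rpow_mul two_pos.le, ← rpow_mul two_pos.le, div_eq_mul_inv, ← rpow_neg two_pos.le]
        ring_nf
      rw [hpow, ← mul_assoc, hKq, div_div, ← pow_succ] at h
      rw [pow_succ q]
      nlinarith
  have hfin : Tendsto (fun N : ℕ => A (ρ / 2 ^ N) + K) atTop (𝓝 K) := by
    simpa using hlim.add_const K
  exact ge_of_tendsto' hfin fun N =>
    (le_add_of_nonneg_right (by positivity)).trans (hind N)

/-- The constant in the curvature estimate for layers bent along spheres. -/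
noncomputable def curvConst (n : ℕ) (s : ℝ) : ℝ :=
  alphaC n s * 2 ^ ((n : ℝ) + s) * 2 ^ n * unitVol n / (1 - 2 ^ (-(1 - s))) + 2 * kerMass n s

theorem curvConst_nonneg (hn : 1 ≤ n) (hs : s ∈ Ioo (0 : ℝ) 1) : 0 ≤ curvConst n s := by
  have h1 := alphaC_pos hn hs
  have h2 := unitVol_pos (n := n)
  have h3 := kerMass_nonneg hn hs
  have h4 : (2 : ℝ) ^ (-(1 - s)) < 1 :=
    rpow_lt_one_of_one_lt_of_neg one_lt_two (by linarith [hs.2])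
  have h5 : 0 < 1 - (2 : ℝ) ^ (-(1 - s)) := by linarith
  unfold curvConst
  positivity

/-- Bending a planar layer along a paraboloid of curvature radius `ρ` costs `O(ρ^{-s})`,
uniformly in the profile and in the truncation. -/
theorem integral_bend_le (hn : 1 ≤ n) (hs : s ∈ Ioo (0 : ℝ) 1) {δ ρ : ℝ} (hδ : 0 < δ)
    (hρ : 0 < ρ) {e : Rn n} (he : ‖e‖ = 1) {f : ℝ → ℝ} (hf : IsOddProfile f) (τ : ℝ) :
    ∫ w, (f (τ + inner ℝ e w + ‖w‖ ^ 2 / (2 * ρ)) - f (τ + inner ℝ e w)) * tker n s δ w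
      ≤ curvConst n s * ρ ^ (-s) := by
  set G : Rn n → ℝ := fun w => f (τ + inner ℝ e w + ‖w‖ ^ 2 / (2 * ρ)) - f (τ + inner ℝ e w)
    with hG
  have hα := alphaC_pos hn hs
  have hU := unitVol_pos (n := n)
  have hfm := hf.mono.measurable
  have hGm : Measurable G := (hfm.comp (by fun_prop)).sub (hfm.comp (by fun_prop))
  have hG0 : ∀ w, 0 ≤ G w := fun w => sub_nonneg.2 (hf.mono (by
    have : 0 ≤ ‖w‖ ^ 2 / (2 * ρ) := by positivity
    linarith))
  have hG2 : ∀ w, G w ≤ 2 := fun w => by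
    have h1 := abs_le.1 (hf.abs_le (τ + inner ℝ e w + ‖w‖ ^ 2 / (2 * ρ)))
    have h2 := abs_le.1 (hf.abs_le (τ + inner ℝ e w))
    simp only [hG]; linarith [h1.2, h2.1]
  have hGint : Integrable (fun w => G w * tker n s δ w) :=
    integrable_mul_tker hn hs hδ hGm fun w => by rw [abs_of_nonneg (hG0 w)]; exact hG2 w
  set A : ℝ → ℝ := fun r => ∫ w in ball 0 r, G w * tker n s δ w with hA
  set D := alphaC n s * 2 ^ ((n : ℝ) + s) * 2 ^ n * unitVol n with hD
  have hD0 : 0 ≤ D := by positivity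
  have hstep : ∀ r, 0 < r → r ≤ ρ → A r ≤ A (r / 2) + D / ρ * r ^ (1 - s) := by
    intro r hr hrρ
    have hsub : ball (0 : Rn n) (r / 2) ⊆ ball 0 r := ball_subset_ball (by linarith)
    have hsplit := setIntegral_sdiff (f := fun w => G w * tker n s δ w) (μ := volume)
      (measurableSet_ball (x := (0 : Rn n)) (ε := r / 2)) hGint.integrableOn hsub
    set h := r * (r / (2 * ρ)) with hh
    have hh0 : 0 ≤ h := by positivity
    set F : Rn n → ℝ := fun w => f (τ + inner ℝ e (w + h • e)) - f (τ + inner ℝ e w) with hF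
    have hFint : IntegrableOn F (ball 0 r) :=
      Measure.integrableOn_of_bounded (M := 2) measure_ball_lt_top.ne
        ((hfm.comp (by fun_prop)).sub (hfm.comp (by fun_prop))).aestronglyMeasurable
        (ae_of_all _ fun w => by
          refine (abs_sub _ _).trans ?_
          linarith [hf.abs_le (τ + inner ℝ e (w + h • e)), hf.abs_le (τ + inner ℝ e w)])
    have hinner : ∀ w, inner ℝ e (w + h • e) = inner ℝ e w + h := fun w => by
      rw [inner_add_right, inner_smul_right, real_inner_self_eq_norm_sq, he]; ring
    have hF0 : ∀ w, 0 ≤ F w := fun w => sub_nonneg.2 (hf.mono (by rw [hinner]; linarith))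
    set κ := alphaC n s * (r / 2) ^ (-((n : ℝ) + s)) with hκ
    have hκ0 : 0 ≤ κ := mul_nonneg hα.le (rpow_nonneg (by positivity) _)
    have h1 : ∫ w in ball 0 r \ ball 0 (r / 2), G w * tker n s δ w
        ≤ ∫ w in ball 0 r \ ball 0 (r / 2), κ * F w := by
      refine setIntegral_mono_on hGint.integrableOn
        ((hFint.mono_set sdiff_subset).const_mul κ)
        (measurableSet_ball.diff measurableSet_ball) fun w hw => ?_
      obtain ⟨hw1, hw2⟩ := hw
      rw [mem_ball_zero_iff] at hw1 hw2
      rw [not_lt] at hw2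
      rw [mul_comm]
      refine mul_le_mul (tker_le hn hs (by positivity) (hw2.trans (le_max_left _ _))) ?_
        (hG0 w) hκ0
      refine sub_le_sub_right (hf.mono ?_) _
      rw [hinner, hh, ← add_assoc]
      have : ‖w‖ ^ 2 ≤ r ^ 2 := pow_le_pow_left₀ (norm_nonneg _) hw1.le 2
      have : ‖w‖ ^ 2 / (2 * ρ) ≤ r ^ 2 / (2 * ρ) := by gcongr
      have : r * (r / (2 * ρ)) = r ^ 2 / (2 * ρ) := by ring
      linarith
    have h2 : ∫ w in ball 0 r \ ball 0 (r / 2), κ * F w ≤ κ * ∫ w in ball 0 r, F w := by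
      rw [integral_const_mul]
      exact mul_le_mul_of_nonneg_left
        (setIntegral_mono_set hFint (ae_of_all _ hF0) sdiff_subset.eventuallyLE) hκ0
    have h3 : ∫ w in ball 0 r, F w ≤ 2 * ((r + h) ^ n - r ^ n) * unitVol n :=
      setIntegral_shift_sub_le (f := fun w => f (τ + inner ℝ e w)) (hfm.comp (by fun_prop))
        (fun w => hf.abs_le _) hr hh0 (by rw [norm_smul, he, mul_one, norm_of_nonneg hh0])
    have h4 : (r + h) ^ n - r ^ n ≤ r ^ n * (2 ^ n * (r / (2 * ρ))) :=
      add_pow_sub_pow_le hr.le (by positivity) ((div_le_one (by positivity)).2 (by linarith)) n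
    have h5 : κ * (2 * (r ^ n * (2 ^ n * (r / (2 * ρ)))) * unitVol n) = D / ρ * r ^ (1 - s) := by
      have e1 : (r / 2) ^ (-((n : ℝ) + s)) = r ^ (-((n : ℝ) + s)) * 2 ^ ((n : ℝ) + s) := by
        rw [div_rpow hr.le two_pos.le, rpow_neg two_pos.le, div_inv_eq_mul]
      have e2 : r ^ (1 - s) = r ^ (-((n : ℝ) + s)) * r ^ n * r := by
        rw [show 1 - s = -((n : ℝ) + s) + n + 1 by ring, rpow_add hr, rpow_add hr, rpow_natCast,
          rpow_one]
      rw [hκ, hD, e1, e2]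
      field_simp
    have h6 : κ * ∫ w in ball 0 r, F w ≤ D / ρ * r ^ (1 - s) := by
      rw [← h5]
      refine mul_le_mul_of_nonneg_left (h3.trans ?_) hκ0
      exact mul_le_mul_of_nonneg_right (by linarith) hU.le
    simp only [hA]
    linarith
  have hlim : Tendsto (fun N : ℕ => A (ρ / 2 ^ N)) atTop (𝓝 0) := by
    set M := 2 * (alphaC n s * δ ^ (-((n : ℝ) + s))) with hM
    have hb : ∀ r, 0 < r → A r ≤ M * (r ^ n * unitVol n) := fun r hr => by
      have : A r ≤ ∫ _ in ball (0 : Rn n) r, M :=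
        setIntegral_mono hGint.integrableOn (integrableOn_const measure_ball_lt_top.ne)
          fun w => mul_le_mul (hG2 w) (tker_le hn hs hδ (le_max_right _ _))
            (tker_nonneg hn hs δ w) zero_le_two
      rwa [setIntegral_const, volume_real_ball_Rn _ hr, smul_eq_mul, mul_comm] at this
    have hpow : Tendsto (fun N : ℕ => ρ / 2 ^ N) atTop (𝓝 (0 : ℝ)) := by
      have := (tendsto_pow_atTop_nhds_zero_of_lt_one (r := (1 / 2 : ℝ)) (by norm_num)
        (by norm_num)).const_mul ρ
      simpa [div_eq_mul_inv] using this
    have htop : Tendsto (fun N : ℕ => M * ((ρ / 2 ^ N) ^ n * unitVol n)) atTop (𝓝 0) := by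
      have := ((hpow.pow n).mul_const (unitVol n)).const_mul M
      rwa [zero_pow (by omega), zero_mul, mul_zero] at this
    refine squeeze_zero (fun N => ?_) (fun N => hb _ (by positivity)) htop
    exact integral_nonneg fun w => mul_nonneg (hG0 w) (tker_nonneg hn hs δ w)
  have hin := dyadic_sum_le hρ (by positivity) (by linarith [hs.2]) hstep hlim
  rw [← integral_add_compl (measurableSet_ball (x := (0 : Rn n)) (ε := ρ)) hGint]
  have hout := setIntegral_compl_ball_mul_tker_le (δ := δ) hn hs hρ zero_le_two hG2
  have hpow : D / ρ * ρ ^ (1 - s) = D * ρ ^ (-s) := by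
    rw [show 1 - s = -s + 1 by ring, rpow_add hρ, rpow_one]
    field_simp
  rw [hpow] at hin
  refine (add_le_add hin hout).trans (le_of_eq ?_)
  rw [curvConst]
  ring

end Curvature

section Solutions

variable {n : ℕ} {s : ℝ}

/-- Lipschitz solutions with values in `(-1,1)`, in translated form and with general
reaction coefficient `lam`. -/
structure IsLipSol (n : ℕ) (s lam K : ℝ) (u : Rn n → ℝ) (O : Set (Rn n)) : Prop where
  neg_one_lt : ∀ x, -1 < u x
  lt_one : ∀ x, u x < 1
  lip_nonneg : 0 ≤ K
  lip : ∀ x y, |u x - u y| ≤ K * ‖x - y‖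
  eqn : ∀ x ∈ O, (∫ w, (u x - u (x + w)) * fker n s w) + lam * (u x ^ 3 - u x) = 0

theorem IsLipSol.continuous {lam K : ℝ} {u : Rn n → ℝ} {O : Set (Rn n)}
    (hu : IsLipSol n s lam K u O) : Continuous u :=
  (LipschitzWith.of_dist_le_mul (K := ⟨K, hu.lip_nonneg⟩) fun x y => by
    rw [dist_eq_norm, dist_eq_norm]; exact hu.lip x y).continuous

theorem IsLipSol.neg {lam K : ℝ} {u : Rn n → ℝ} {O : Set (Rn n)}
    (hu : IsLipSol n s lam K u O) : IsLipSol n s lam K (fun x => -u x) O where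
  neg_one_lt x := neg_lt_neg (hu.lt_one x)
  lt_one x := neg_lt.1 (hu.neg_one_lt x)
  lip_nonneg := hu.lip_nonneg
  lip x y := by
    rw [neg_sub_neg, abs_sub_comm]
    exact hu.lip x y
  eqn x hx := by
    have h := hu.eqn x hx
    have : ∀ w, (-u x - -u (x + w)) * fker n s w = -((u x - u (x + w)) * fker n s w) :=
      fun w => by ring
    simp_rw [this, integral_neg]
    linarith

theorem IsACSol.isLipSol {ε K : ℝ} {u : Rn n → ℝ} {O : Set (Rn n)}
    (hr : ∀ x, u x ∈ Ioo (-1 : ℝ) 1) (hu : ContDiff ℝ 1 u) (hK : ∀ x, ‖fderiv ℝ u x‖ ≤ K)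
    (hsol : IsACSol n s ε u O) : IsLipSol n s (ε ^ (-s)) K u O where
  neg_one_lt x := (hr x).1
  lt_one x := (hr x).2
  lip_nonneg := (norm_nonneg _).trans (hK 0)
  lip x y := by
    have := (convex_univ (𝕜 := ℝ) (E := Rn n)).norm_image_sub_le_of_norm_fderiv_le (f := u)
      (C := K) (fun x _ => (hu.differentiable one_ne_zero) x) (fun x _ => hK x) (mem_univ y)
      (mem_univ x)
    exact this
  eqn x hx := by
    rw [← hsol x hx, ← integral_add_left_eq_self (fun y => (u x - u y) * fracKer n s x y) x]
    congr 3 with w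
    rw [fracKer, fker, sub_add_cancel_left, norm_neg]

theorem IsLipSol.abs_sub_le {lam K : ℝ} {u : Rn n → ℝ} {O : Set (Rn n)}
    (hu : IsLipSol n s lam K u O) (x w : Rn n) :
    |u x - u (x + w)| ≤ max 2 K * min 1 (‖w‖ / 1) := by
  have h1 := hu.lip x (x + w)
  rw [sub_add_cancel_left, norm_neg] at h1
  have h2 : |u x - u (x + w)| ≤ 2 := abs_le.2
    ⟨by linarith [hu.neg_one_lt x, hu.lt_one (x + w)],
      by linarith [hu.neg_one_lt (x + w), hu.lt_one x]⟩
  rw [div_one, mul_min_of_nonneg _ _ (zero_le_two.trans (le_max_left 2 K)), mul_one]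
  exact le_min (h2.trans (le_max_left _ _))
    (h1.trans (mul_le_mul_of_nonneg_right (le_max_right _ _) (norm_nonneg _)))

theorem IsLipSol.integrable (hn : 1 ≤ n) (hs : s ∈ Ioo (0 : ℝ) 1) {lam K : ℝ} {u : Rn n → ℝ}
    {O : Set (Rn n)} (hu : IsLipSol n s lam K u O) (x : Rn n) :
    Integrable fun w => (u x - u (x + w)) * fker n s w := by
  have := hu.continuous
  exact integrable_mul_ker hn hs one_pos (Continuous.measurable (by fun_prop)) (hu.abs_sub_le x)

theorem IsLipSol.integrable_truncated (hn : 1 ≤ n) (hs : s ∈ Ioo (0 : ℝ) 1) {lam K δ : ℝ}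
    (hδ : 0 < δ) {u : Rn n → ℝ} {O : Set (Rn n)} (hu : IsLipSol n s lam K u O) (x : Rn n) :
    Integrable fun w => (u x - u (x + w)) * tker n s δ w := by
  have := hu.continuous
  exact integrable_mul_tker hn hs hδ (Continuous.measurable (by fun_prop)) fun w =>
    (hu.abs_sub_le x w).trans (mul_le_of_le_one_right (by positivity) (min_le_left _ _))

/-- Truncating the kernel at scale `δ` changes the nonlocal term by `O(δ^{1-s})`. -/
theorem IsLipSol.truncated_le (hn : 1 ≤ n) (hs : s ∈ Ioo (0 : ℝ) 1) {lam K δ : ℝ} (hδ : 0 < δ)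
    {u : Rn n → ℝ} {O : Set (Rn n)} (hu : IsLipSol n s lam K u O) {x : Rn n} (hx : x ∈ O) :
    ∫ w, (u x - u (x + w)) * tker n s δ w
      ≤ lam * (u x - u x ^ 3) + K * (δ ^ (1 - s) * kerMass n s) := by
  have hint := hu.integrable_truncated hn hs hδ x
  have hle : ∀ᵐ w : Rn n, (u x - u (x + w)) * tker n s δ w
      ≤ (u x - u (x + w)) * fker n s w + K * δ * (min 1 (‖w‖ / δ) * fker n s w) := by
    filter_upwards [ae_ne_zero_Rn hn] with w hw
    have hk := ker_nonneg hn hs w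
    have hKδ := mul_nonneg hu.lip_nonneg hδ.le
    rcases le_or_gt δ ‖w‖ with h | h
    · rw [tker_eq_ker h]
      exact le_add_of_nonneg_right (mul_nonneg hKδ
        (mul_nonneg (le_min zero_le_one (by positivity)) hk))
    · rw [min_eq_right ((div_le_one hδ).2 h.le)]
      have h1 : |u x - u (x + w)| ≤ K * ‖w‖ := by
        simpa using hu.lip x (x + w)
      have h2 := mul_le_mul (neg_le.1 (abs_le.1 h1).1)
        (sub_le_self (fker n s w) (tker_nonneg hn hs δ w)) (sub_nonneg.2 (tker_le_ker hn hs hw))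
        (mul_nonneg hu.lip_nonneg (norm_nonneg w))
      have h3 : K * δ * (‖w‖ / δ * fker n s w) = K * ‖w‖ * fker n s w := by field_simp
      rw [h3]
      linarith
  have hmain := integral_mono_ae hint ((hu.integrable hn hs x).add
    ((integrable_min_mul_ker hn hs hδ).const_mul (K * δ))) hle
  rw [integral_add' (hu.integrable hn hs x) ((integrable_min_mul_ker hn hs hδ).const_mul (K * δ)),
    integral_const_mul, integral_min_mul_ker hδ] at hmain
  have hpow : K * δ * (δ ^ (-s) * kerMass n s) = K * (δ ^ (1 - s) * kerMass n s) := by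
    rw [show 1 - s = -s + 1 by ring, rpow_add hδ, rpow_one]; ring
  rw [hpow] at hmain
  linarith [hu.eqn x hx]

/-- Radial cut-off vanishing on the ball of radius `k r` and equal to `1` outside the ball of
radius `(k+1) r`. -/
noncomputable def ramp (k r : ℝ) (z x : Rn n) : ℝ := min 1 (max 0 (‖x - z‖ / r - k))

theorem continuous_ramp (k r : ℝ) (z : Rn n) : Continuous (ramp k r z) := by
  unfold ramp; fun_prop

theorem abs_ramp_sub_le {k r : ℝ} (hr : 0 < r) (z x w : Rn n) :
    |ramp k r z x - ramp k r z (x + w)| ≤ min 1 (‖w‖ / r) := by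
  have h0 : ∀ y, 0 ≤ ramp k r z y := fun y => le_min zero_le_one (le_max_left _ _)
  have h1 : ∀ y, ramp k r z y ≤ 1 := fun y => min_le_left _ _
  refine le_min (abs_le.2 ⟨by linarith [h0 x, h1 (x + w)], by linarith [h0 (x + w), h1 x]⟩) ?_
  unfold ramp
  refine (abs_min_sub_min_le_max _ _ _ _).trans ?_
  rw [sub_self, abs_zero, max_eq_right (abs_nonneg _)]
  refine (abs_max_sub_max_le_max _ _ _ _).trans ?_
  rw [sub_self, abs_zero, max_eq_right (abs_nonneg _), sub_sub_sub_cancel_right, ← sub_div,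
    abs_div, abs_of_pos hr]
  refine div_le_div_of_nonneg_right ((abs_norm_sub_norm_le _ _).trans (le_of_eq ?_)) hr.le
  rw [← norm_neg]
  congr 1
  abel

/-- Touching a solution from above by a multiple of a radial cut-off. -/
theorem IsLipSol.exists_contact_ramp (hn : 1 ≤ n) (hs : s ∈ Ioo (0 : ℝ) 1) {lam K k r : ℝ}
    (hr : 0 < r) {u : Rn n → ℝ} {O : Set (Rn n)} (hu : IsLipSol n s lam K u O)
    {z x₁ : Rn n} (hO : ball z ((k + 1) * r) ⊆ O) (hx₁ : ‖x₁ - z‖ ≤ k * r) :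
    ∃ x₀ ∈ ball z ((k + 1) * r), u x₁ ≤ u x₀ ∧ ∃ E : Rn n → ℝ, Continuous E ∧ (∀ w, 0 ≤ E w) ∧
      (∀ w, u x₀ - u (x₀ + w) ≤ E w + 2 * min 1 (‖w‖ / r)) ∧
      Integrable (fun w => E w * fker n s w) ∧
      ∫ w, E w * fker n s w ≤ lam * (u x₀ - u x₀ ^ 3) + 2 * (r ^ (-s) * kerMass n s) := by
  have hcont := hu.continuous
  have hq := continuous_ramp k r z
  set f : Rn n → ℝ := fun x => u x - 2 * ramp k r z x with hf
  have hfc : Continuous f := by fun_prop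
  have hin : x₁ ∈ closedBall z ((k + 1) * r) := by
    rw [mem_closedBall, dist_eq_norm]; nlinarith
  obtain ⟨x₀, hx₀, hmax⟩ := (isCompact_closedBall z ((k + 1) * r)).exists_isMaxOn ⟨x₁, hin⟩
    hfc.continuousOn
  have hfx₁ : f x₁ = u x₁ := by
    have : ‖x₁ - z‖ / r - k ≤ 0 := by
      rw [sub_nonpos, div_le_iff₀ hr]; exact hx₁
    simp [hf, ramp, max_eq_left this]
  have hout : ∀ y, (k + 1) * r ≤ ‖y - z‖ → f y < -1 := fun y hy => by
    have : 1 ≤ ‖y - z‖ / r - k := by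
      rw [le_sub_iff_add_le, le_div_iff₀ hr]; linarith
    have : ramp k r z y = 1 := by
      rw [ramp, min_eq_left (this.trans (le_max_right _ _))]
    simp only [hf, this]
    linarith [hu.lt_one y]
  have h₁₀ : u x₁ ≤ f x₀ := hfx₁ ▸ hmax hin
  have hball : x₀ ∈ ball z ((k + 1) * r) := by
    rw [mem_ball, dist_eq_norm]
    by_contra! h
    linarith [hout x₀ h, hu.neg_one_lt x₁]
  have hglob : ∀ y, f y ≤ f x₀ := fun y => by
    rcases le_or_gt ‖y - z‖ ((k + 1) * r) with h | h
    · exact hmax (by rwa [mem_closedBall, dist_eq_norm])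
    · linarith [hout y h.le, hu.neg_one_lt x₁]
  have hr0 : 0 ≤ ramp k r z x₀ := le_min zero_le_one (le_max_left _ _)
  have hfx₀ : f x₀ ≤ u x₀ := by simp only [hf]; linarith
  set q : Rn n → ℝ := fun w => 2 * (ramp k r z (x₀ + w) - ramp k r z x₀) with hqdef
  have hqb : ∀ w, |q w| ≤ 2 * min 1 (‖w‖ / r) := fun w => by
    rw [hqdef]; simp only
    rw [abs_mul, abs_of_pos (two_pos : (0 : ℝ) < 2), abs_sub_comm]
    exact mul_le_mul_of_nonneg_left (abs_ramp_sub_le hr z x₀ w) zero_le_two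
  have hqm : Measurable q := Continuous.measurable (by fun_prop)
  have hi1 := hu.integrable hn hs x₀
  have hi2 := integrable_mul_ker hn hs hr hqm hqb
  have hE : ∀ w, (u x₀ - u (x₀ + w) + q w) * fker n s w
      = (u x₀ - u (x₀ + w)) * fker n s w + q w * fker n s w := fun w => add_mul _ _ _
  refine ⟨x₀, hball, h₁₀.trans hfx₀, fun w => u x₀ - u (x₀ + w) + q w, by fun_prop, fun w => ?_,
    fun w => ?_, ?_, ?_⟩
  · have := hglob (x₀ + w)
    simp only [hf] at this
    simp only [hqdef]
    linarith
  · linarith [(abs_le.1 (hqb w)).1]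
  · simp_rw [hE]
    exact hi1.add hi2
  · simp_rw [hE]
    rw [integral_add hi1 hi2]
    linarith [hu.eqn x₀ (hO hball), integral_mul_ker_le hn hs hr hqm hqb]

theorem integrableOn_ball_of_continuous {f : Rn n → ℝ} (hf : Continuous f) (x : Rn n) (r : ℝ) :
    IntegrableOn f (ball x r) :=
  (hf.continuousOn.integrableOn_compact (isCompact_closedBall x r)).mono_set
    ball_subset_closedBall

theorem div_rpow_neg_le (hs : s ∈ Ioo (0 : ℝ) 1) {t c : ℝ} (ht : 0 < t) (hc : 1 ≤ c) :
    (t / c) ^ (-s) ≤ c * t ^ (-s) := by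
  have hc0 : 0 ≤ c := zero_le_one.trans hc
  rw [div_rpow ht.le hc0, rpow_neg hc0, div_inv_eq_mul, mul_comm]
  refine mul_le_mul_of_nonneg_right ?_ (rpow_nonneg ht.le _)
  simpa using rpow_le_rpow_of_exponent_le hc hs.2.le

theorem div_kernel_scale (C α : ℝ) {κ t : ℝ} (hκ : 0 < κ) (ht : 0 < t) :
    C * t ^ (-s) / (α * (κ * t) ^ (-((n : ℝ) + s))) = κ ^ s * (C / α) * (κ ^ n * t ^ n) := by
  have e1 : t ^ (-s) = t ^ (-((n : ℝ) + s)) * t ^ n := by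
    rw [← rpow_natCast, ← rpow_add ht]; ring_nf
  have e2 : κ ^ s * κ ^ n = (κ ^ (-((n : ℝ) + s)))⁻¹ := by
    rw [← rpow_natCast, ← rpow_add hκ, ← rpow_neg hκ.le]; ring_nf
  have h1 := (rpow_pos_of_pos hκ (-((n : ℝ) + s))).ne'
  have h2 := (rpow_pos_of_pos ht (-((n : ℝ) + s))).ne'
  rw [mul_rpow hκ.le ht.le, e1]
  calc _ = C / α * t ^ n * (κ ^ (-((n : ℝ) + s)))⁻¹ := by field_simp
    _ = _ := by rw [← e2]; ring

/-- Where a solution is below `-9/10`, it converges to `-1` at an algebraic rate. -/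
theorem IsLipSol.decay (hn : 1 ≤ n) (hs : s ∈ Ioo (0 : ℝ) 1) {lam K t : ℝ} (hlam : 0 < lam)
    (ht : 0 < t) {u : Rn n → ℝ} {O : Set (Rn n)} (hu : IsLipSol n s lam K u O) {z : Rn n}
    (hO : ball z (3 * t / 4) ⊆ O) (hz : ∀ x ∈ ball z (3 * t / 4), u x ≤ -(9 / 10)) {x : Rn n}
    (hx : ‖x - z‖ ≤ t / 2) : u x ≤ -1 + 8 * kerMass n s * t ^ (-s) / lam := by
  have hrad : (2 + 1) * (t / 4) = 3 * t / 4 := by ring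
  obtain ⟨x₀, hx₀, hle, E, -, hE0, -, -, hE⟩ := hu.exists_contact_ramp hn hs (k := 2) (r := t / 4)
    (z := z) (x₁ := x) (by positivity) (by rwa [hrad]) (by linarith)
  have h0 : 0 ≤ ∫ w, E w * fker n s w :=
    integral_nonneg fun w => mul_nonneg (hE0 w) (ker_nonneg hn hs w)
  have hpow := div_rpow_neg_le hs ht (by norm_num : (1 : ℝ) ≤ 4)
  have h1 := mul_le_mul_of_nonneg_right hpow (kerMass_nonneg hn hs)
  have h2 := hz x₀ (by rwa [← hrad])
  have h3 := hu.neg_one_lt x₀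
  have h4 : 1 + u x₀ ≤ -(u x₀ - u x₀ ^ 3) := by
    have : 1 ≤ u x₀ * (u x₀ - 1) := by nlinarith
    nlinarith [mul_nonneg (sub_nonneg.2 h3.le) (sub_nonneg.2 this)]
  have h5 := mul_le_mul_of_nonneg_left h4 hlam.le
  have h6 : 1 + u x₀ ≤ 8 * kerMass n s * t ^ (-s) / lam := by
    rw [le_div_iff₀ hlam]; linarith
  linarith

theorem exists_pos_rpow_mul_le (hs : 0 < s) (C : ℝ) {b η : ℝ} (hb : 0 < b) (hη : 0 < η) :
    ∃ κ, 0 < κ ∧ κ ≤ b ∧ κ ^ s * C ≤ η := by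
  have h : Tendsto (fun κ : ℝ => κ ^ s * C) (𝓝[>] 0) (𝓝 0) := by
    have : Tendsto (fun κ : ℝ => κ ^ s * C) (𝓝 0) (𝓝 ((0 : ℝ) ^ s * C)) :=
      ((continuousAt_rpow_const _ _ (Or.inr hs.le)).tendsto).mul_const C
    rw [zero_rpow hs.ne', zero_mul] at this
    exact this.mono_left nhdsWithin_le_nhds
  obtain ⟨κ, h1, h2⟩ := ((h.eventually_le_const hη).and (Ioo_mem_nhdsGT hb)).exists
  exact ⟨κ, h2.1, h2.2.le, h1⟩

/-- Lower bounds on a kernel transfer weighted integral bounds to plain ones. -/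
theorem setIntegral_le_of_le_kernel {E k : Rn n → ℝ} {A : Set (Rn n)} {c : ℝ} (hc : 0 < c)
    (hA : MeasurableSet A) (hE : ∀ w, 0 ≤ E w) (hk : ∀ w, 0 ≤ k w)
    (hEA : IntegrableOn E A) (hint : Integrable fun w => E w * k w)
    (hle : ∀ᵐ w, w ∈ A → c ≤ k w) :
    ∫ w in A, E w ≤ (∫ w, E w * k w) / c := by
  rw [le_div_iff₀ hc, ← integral_mul_const]
  refine (setIntegral_mono_on_ae (hEA.mul_const c) hint.integrableOn hA ?_).trans
    (setIntegral_le_integral hint (ae_of_all _ fun w => mul_nonneg (hE w) (hk w)))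
  filter_upwards [hle] with w hw hwA
  exact mul_le_mul_of_nonneg_left (hw hwA) (hE w)

theorem setIntegral_ball_shift (f : Rn n → ℝ) (x c : Rn n) (r : ℝ) :
    ∫ w in ball c r, f (x + w) = ∫ y in ball (x + c) r, f y := by
  have := (measurePreserving_add_left (volume : Measure (Rn n)) x).setIntegral_preimage_emb
    (measurableEmbedding_addLeft x) f (ball (x + c) r)
  rw [← this]
  congr 2
  ext w; simp [mem_ball, dist_eq_norm]

/-- At the critical scale, a point where `u ≥ -9/10` carries a definite amount of mass. -/
theorem exists_mass_of_point (hn : 1 ≤ n) (hs : s ∈ Ioo (0 : ℝ) 1) {Λ : ℝ} (hΛ : 0 < Λ) :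
    ∃ c, 0 < c ∧ ∀ (lam K r : ℝ) (u : Rn n → ℝ) (O : Set (Rn n)) (x₁ : Rn n), 0 < r →
      lam * r ^ s = Λ → IsLipSol n s lam K u O → ball x₁ r ⊆ O → -(9 / 10) ≤ u x₁ →
        c * r ^ n ≤ ∫ x in ball x₁ (2 * r), (1 + u x) := by
  have hα := alphaC_pos hn hs
  have hU := unitVol_pos (n := n)
  obtain ⟨κ, hκ, hκ40, hκs⟩ := exists_pos_rpow_mul_le hs.1
    ((Λ + 2 * kerMass n s) / alphaC n s) (b := 1 / 40) (by norm_num)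
    (η := 1 / 40 * unitVol n) (by positivity)
  refine ⟨1 / 40 * unitVol n * κ ^ n, by positivity,
    fun lam K r u O x₁ hr hlam hu hO hx₁ => ?_⟩
  have hcont := hu.continuous
  obtain ⟨x₀, hx₀, hle, E, hEc, hE0, hEu, hEi, hE⟩ := hu.exists_contact_ramp hn hs (k := 0)
    (z := x₁) (x₁ := x₁) hr (by simpa using hO) (by simp)
  have hlam0 : 0 < lam := pos_of_mul_pos_left (hlam ▸ hΛ) (rpow_nonneg hr.le _)
  have hlamr : lam = Λ * r ^ (-s) := by
    rw [← hlam, mul_assoc, ← rpow_add hr, add_neg_cancel, rpow_zero, mul_one]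
  have hh : u x₀ - u x₀ ^ 3 ≤ 1 := by
    nlinarith [hu.neg_one_lt x₀, hu.lt_one x₀, sq_nonneg (u x₀),
      mul_pos (sub_pos.2 (hu.lt_one x₀)) (sub_pos.2 (hu.lt_one x₀)),
      mul_nonneg (sq_nonneg (u x₀)) (neg_le_iff_add_nonneg.1 (hu.neg_one_lt x₀).le)]
  have hE' : ∫ w, E w * fker n s w ≤ (Λ + 2 * kerMass n s) * r ^ (-s) := by
    have := mul_le_mul_of_nonneg_left hh hlam0.le
    rw [mul_one] at this
    rw [hlamr] at this hE
    linarith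
  have hκr : 0 < κ * r := by positivity
  have hcpos : 0 < alphaC n s * (κ * r) ^ (-((n : ℝ) + s)) := mul_pos hα (rpow_pos_of_pos hκr _)
  have hEon := integrableOn_ball_of_continuous hEc 0 (κ * r)
  have hEball := setIntegral_le_of_le_kernel hcpos (measurableSet_ball (x := (0 : Rn n))
    (ε := κ * r)) hE0 (ker_nonneg hn hs) hEon hEi (by
      filter_upwards [ae_ne_zero_Rn hn] with w hw hwA
      exact mul_le_mul_of_nonneg_left (rpow_le_rpow_of_nonpos (norm_pos_iff.2 hw)
        (mem_ball_zero_iff.1 hwA).le (neg_exponent_nonpos hs)) hα.le)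
  have hball : ∫ w in ball 0 (κ * r), E w ≤ 1 / 40 * unitVol n * (κ ^ n * r ^ n) := by
    refine hEball.trans ((div_le_div_of_nonneg_right hE' hcpos.le).trans ?_)
    rw [div_kernel_scale _ _ hκ hr]
    exact mul_le_mul_of_nonneg_right hκs (by positivity)
  have hpt : ∫ w in ball 0 (κ * r), ((1 / 20 : ℝ) - E w)
      ≤ ∫ w in ball 0 (κ * r), (1 + u (x₀ + w)) := by
    refine setIntegral_mono_on ((integrableOn_const measure_ball_lt_top.ne).sub hEon)
      (integrableOn_ball_of_continuous (by fun_prop) _ _) measurableSet_ball fun w hw => ?_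
    have h1 := hEu w
    have h2 : min 1 (‖w‖ / r) ≤ κ := (min_le_right _ _).trans
      ((div_le_iff₀ hr).2 (mem_ball_zero_iff.1 hw).le)
    linarith
  have hconst : IntegrableOn (fun _ => (1 / 20 : ℝ)) (ball (0 : Rn n) (κ * r)) :=
    integrableOn_const measure_ball_lt_top.ne
  rw [integral_sub hconst hEon, setIntegral_const, volume_real_ball_Rn _ hκr, smul_eq_mul, mul_pow,
    setIntegral_ball_shift (fun y => 1 + u y), add_zero] at hpt
  have hmono : ∫ y in ball x₀ (κ * r), (1 + u y) ≤ ∫ y in ball x₁ (2 * r), (1 + u y) := by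
    refine setIntegral_mono_set (integrableOn_ball_of_continuous (by fun_prop) _ _) (ae_of_all _ fun y => ?_)
      (ball_subset_ball' ?_).eventuallyLE
    · have := hu.neg_one_lt y
      simp only [Pi.zero_apply]; linarith
    · have : dist x₀ x₁ < r := by simpa using hx₀
      nlinarith
  linarith

end Solutions

section Touching

variable {n : ℕ} {s : ℝ}

/-- Continuous planar layers for the equation with truncated kernel. -/
structure IsLayer (n : ℕ) (s δ lam : ℝ) (φ : ℝ → ℝ) : Prop extends IsOddProfile φ where
  cont : Continuous φ
  eqn : ∀ e : Rn n, ‖e‖ = 1 → ∀ x,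
    ∫ z, (φ x - φ (x + inner ℝ e z)) * tker n s δ z = lam * (φ x - φ x ^ 3)
  decay : ∀ L, 0 < L → 1 - 2 * kerMass n s * L ^ (-s) / lam ≤ φ L

/-- The constant in the upward shift that makes spherical layers strict supersolutions. -/
noncomputable def shiftConst (n : ℕ) (s : ℝ) : ℝ := 8 * kerMass n s + 2 * curvConst n s + 3

theorem shiftConst_pos (hn : 1 ≤ n) (hs : s ∈ Ioo (0 : ℝ) 1) : 0 < shiftConst n s := by
  have := kerMass_nonneg hn hs
  have := curvConst_nonneg hn hs
  unfold shiftConst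
  positivity

/-- The radial supersolution: a layer bent along the sphere of radius `t` around `z`,
slightly shifted upwards. -/
noncomputable def sphericalLayer (n : ℕ) (s lam : ℝ) (φ : ℝ → ℝ) (z : Rn n) (t : ℝ) (x : Rn n) :
    ℝ :=
  φ (‖x - z‖ - t) + shiftConst n s * t ^ (-s) / lam

theorem norm_add_sub_le_paraboloid {x z e : Rn n} {r : ℝ} (hr : 0 < r) (he : ‖e‖ = 1)
    (hx : x - z = r • e) (w : Rn n) : ‖x + w - z‖ ≤ r + inner ℝ e w + ‖w‖ ^ 2 / (2 * r) := by
  have h1 : ‖x + w - z‖ ^ 2 = r ^ 2 + 2 * (r * inner ℝ e w) + ‖w‖ ^ 2 := by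
    rw [add_sub_right_comm, hx, norm_add_sq_real, norm_smul, inner_smul_left, he,
      norm_of_nonneg hr.le]
    simp
  have h2 : r + inner ℝ e w + ‖w‖ ^ 2 / (2 * r) = (r ^ 2 + ‖x + w - z‖ ^ 2) / (2 * r) := by
    rw [h1]; field_simp; ring
  rw [h2, le_div_iff₀ (by positivity)]
  nlinarith [sq_nonneg (‖x + w - z‖ - r)]

theorem IsLayer.one_le_sphericalLayer (hn : 1 ≤ n) (hs : s ∈ Ioo (0 : ℝ) 1) {δ lam t : ℝ}
    {φ : ℝ → ℝ} (hφ : IsLayer n s δ lam φ) (hlam : 0 < lam) (ht : 0 < t) {z x : Rn n}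
    (hx : 2 * t ≤ ‖x - z‖) : 1 ≤ sphericalLayer n s lam φ z t x := by
  have h1 := hφ.decay t ht
  have h2 : φ t ≤ φ (‖x - z‖ - t) := hφ.mono (by linarith)
  have h3 : 2 * kerMass n s * t ^ (-s) / lam ≤ shiftConst n s * t ^ (-s) / lam := by
    have := kerMass_nonneg hn hs
    have := curvConst_nonneg hn hs
    have := rpow_nonneg ht.le (-s)
    gcongr
    unfold shiftConst
    linarith
  unfold sphericalLayer
  linarith

/-- A touching point of a spherical layer lies at distance comparable to the radius. -/
theorem IsLayer.touch_radius (hn : 1 ≤ n) (hs : s ∈ Ioo (0 : ℝ) 1) {lam K δ t : ℝ}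
    {u : Rn n → ℝ} {O : Set (Rn n)} {φ : ℝ → ℝ} {z x₀ : Rn n} (hφ : IsLayer n s δ lam φ)
    (hu : IsLipSol n s lam K u O) (hlam : 0 < lam) (ht : 0 < t)
    (ha : shiftConst n s * t ^ (-s) / lam ≤ 1 / 40) (hO : ball z (3 * t) ⊆ O)
    (hle : ∀ x, u x ≤ sphericalLayer n s lam φ z t x)
    (heq : u x₀ = sphericalLayer n s lam φ z t x₀) : t / 2 < ‖x₀ - z‖ ∧ ‖x₀ - z‖ < 2 * t := by
  have hk := kerMass_nonneg hn hs
  have hcurv := curvConst_nonneg hn hs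
  have hts : 0 < t ^ (-s) := rpow_pos_of_pos ht _
  set a := shiftConst n s * t ^ (-s) / lam with ha_def
  have hφ4 : 1 - a ≤ φ (t / 4) := by
    refine le_trans ?_ (hφ.decay (t / 4) (by positivity))
    have h3 : 2 * kerMass n s * (t / 4) ^ (-s) / lam ≤ a := by
      refine div_le_div_of_nonneg_right ?_ hlam.le
      have := mul_le_mul_of_nonneg_left (div_rpow_neg_le hs ht (by norm_num : (1 : ℝ) ≤ 4)) hk
      have : 8 * kerMass n s * t ^ (-s) ≤ shiftConst n s * t ^ (-s) := by
        refine mul_le_mul_of_nonneg_right ?_ hts.le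
        rw [shiftConst]; linarith
      linarith
    linarith
  have hv : ∀ x, sphericalLayer n s lam φ z t x = φ (‖x - z‖ - t) + a := fun x => rfl
  constructor <;> by_contra! h
  · have hsmall : ∀ x ∈ ball z (3 * t / 4), u x ≤ -(9 / 10) := fun x hx => by
      rw [mem_ball, dist_eq_norm] at hx
      have h1 : φ (‖x - z‖ - t) ≤ φ (-(t / 4)) := hφ.mono (by linarith)
      rw [hφ.odd] at h1
      linarith [hle x, hv x]
    have h1 := hu.decay hn hs hlam ht ((ball_subset_ball (by linarith)).trans hO) hsmall h
    have h2 : 8 * kerMass n s * t ^ (-s) / lam < a := by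
      refine div_lt_div_of_pos_right (mul_lt_mul_of_pos_right ?_ hts) hlam
      rw [shiftConst]; linarith
    linarith [(abs_le.1 (hφ.abs_le (‖x₀ - z‖ - t))).1, hv x₀]
  · linarith [hφ.one_le_sphericalLayer hn hs hlam ht h, hu.lt_one x₀]

theorem IsOddProfile.integrable_sub (hn : 1 ≤ n) (hs : s ∈ Ioo (0 : ℝ) 1) {δ : ℝ} (hδ : 0 < δ)
    {φ : ℝ → ℝ} (hφ : IsOddProfile φ) {f g : Rn n → ℝ} (hf : Measurable f) (hg : Measurable g) :
    Integrable fun w => (φ (f w) - φ (g w)) * tker n s δ w :=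
  integrable_mul_tker (M := 2) hn hs hδ ((hφ.mono.measurable.comp hf).sub
    (hφ.mono.measurable.comp hg)) fun w =>
    (abs_sub _ _).trans (by linarith [hφ.abs_le (f w), hφ.abs_le (g w)])

theorem IsLayer.integrable_defect (hn : 1 ≤ n) (hs : s ∈ Ioo (0 : ℝ) 1) {lam K δ : ℝ}
    (hδ : 0 < δ) {u : Rn n → ℝ} {O : Set (Rn n)} {φ : ℝ → ℝ} (hφ : IsLayer n s δ lam φ)
    (hu : IsLipSol n s lam K u O) (z x₀ : Rn n) (t : ℝ) :
    Integrable fun w =>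
      (sphericalLayer n s lam φ z t (x₀ + w) - u (x₀ + w)) * tker n s δ w := by
  have hcont := hu.continuous
  have hφc := hφ.cont
  unfold sphericalLayer
  set a := shiftConst n s * t ^ (-s) / lam
  refine integrable_mul_tker (M := 2 + |a|) hn hs hδ (Continuous.measurable (by fun_prop))
    fun w => (abs_sub _ _).trans ?_
  have h1 := abs_add_le (φ (‖x₀ + w - z‖ - t)) a
  have h2 := hφ.abs_le (‖x₀ + w - z‖ - t)
  have h3 : |u (x₀ + w)| ≤ 1 := abs_le.2 ⟨(hu.neg_one_lt _).le, (hu.lt_one _).le⟩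
  linarith

/-- At a touching point the integrated gap between the spherical layer and the solution is
`O(t^{-s})`, and the touching does not happen deep inside the sphere. -/
theorem IsLayer.touch_defect_le (hn : 1 ≤ n) (hs : s ∈ Ioo (0 : ℝ) 1) {lam K δ t r : ℝ}
    {u : Rn n → ℝ} {O : Set (Rn n)} {φ : ℝ → ℝ} {z x₀ e : Rn n} (hφ : IsLayer n s δ lam φ)
    (hu : IsLipSol n s lam K u O) (hlam : 0 < lam) (hδ : 0 < δ) (ht : 0 < t)
    (ha : shiftConst n s * t ^ (-s) / lam ≤ 1 / 40)
    (hKδ : K * (δ ^ (1 - s) * kerMass n s) ≤ t ^ (-s)) (hO : x₀ ∈ O)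
    (hle : ∀ x, u x ≤ sphericalLayer n s lam φ z t x)
    (heq : u x₀ = sphericalLayer n s lam φ z t x₀)
    (he : ‖e‖ = 1) (hxz : x₀ - z = r • e) (hr : t / 2 < r) :
    -(9 / 10) < φ (r - t) ∧
      ∫ w, (sphericalLayer n s lam φ z t (x₀ + w) - u (x₀ + w)) * tker n s δ w
        ≤ (2 * curvConst n s + 1 + shiftConst n s) * t ^ (-s) := by
  have hk := kerMass_nonneg hn hs
  have hcurv := curvConst_nonneg hn hs
  have hts : 0 < t ^ (-s) := rpow_pos_of_pos ht _
  have hr0 : 0 < r := by linarith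
  have hCa0 := shiftConst_pos hn hs
  set Ca := shiftConst n s with hCa
  set a := Ca * t ^ (-s) / lam with ha_def
  have ha0 : 0 < a := by positivity
  have hlama : lam * a = Ca * t ^ (-s) := by rw [ha_def]; field_simp
  have hv : ∀ x, sphericalLayer n s lam φ z t x = φ (‖x - z‖ - t) + a := fun x => rfl
  have hnorm : ‖x₀ - z‖ = r := by rw [hxz, norm_smul, he, mul_one, norm_of_nonneg hr0.le]
  set τ := r - t with hτ
  have hDi := hφ.integrable_defect hn hs hδ hu z x₀ t
  set D : Rn n → ℝ := fun w => sphericalLayer n s lam φ z t (x₀ + w) - u (x₀ + w) with hD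
  have hGi := hφ.toIsOddProfile.integrable_sub hn hs hδ (n := n)
    (f := fun w => τ + inner ℝ e w + ‖w‖ ^ 2 / (2 * r)) (g := fun w => τ + inner ℝ e w)
    (by fun_prop) (by fun_prop)
  have hPi := hφ.toIsOddProfile.integrable_sub hn hs hδ (n := n)
    (f := fun _ => τ) (g := fun w => τ + inner ℝ e w) (by fun_prop) (by fun_prop)
  have hui := hu.integrable_truncated hn hs hδ x₀
  have hDle : ∀ w, D w * tker n s δ w
      ≤ (φ (τ + inner ℝ e w + ‖w‖ ^ 2 / (2 * r)) - φ (τ + inner ℝ e w)) * tker n s δ w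
      - (φ τ - φ (τ + inner ℝ e w)) * tker n s δ w
      + (u x₀ - u (x₀ + w)) * tker n s δ w := fun w => by
    rw [← sub_mul, ← add_mul]
    refine mul_le_mul_of_nonneg_right ?_ (tker_nonneg hn hs δ w)
    have h1 : φ (‖x₀ + w - z‖ - t) ≤ φ (τ + inner ℝ e w + ‖w‖ ^ 2 / (2 * r)) :=
      hφ.mono (by linarith [norm_add_sub_le_paraboloid hr0 he hxz w])
    simp only [hD, hv]
    rw [heq, hv, hnorm]
    linarith
  have hmain : ∫ w, D w * tker n s δ w ≤ curvConst n s * r ^ (-s) - lam * (φ τ - φ τ ^ 3)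
      + (lam * (u x₀ - u x₀ ^ 3) + t ^ (-s)) := by
    refine (integral_mono hDi ((hGi.sub hPi).add hui) hDle).trans ?_
    rw [integral_add' (hGi.sub hPi) hui, integral_sub' hGi hPi, hφ.eqn e he τ]
    have h1 := integral_bend_le hn hs hδ hr0 he hφ.toIsOddProfile τ
    have h2 := hu.truncated_le hn hs hδ hO
    linarith
  have hrs : r ^ (-s) ≤ 2 * t ^ (-s) :=
    (rpow_le_rpow_of_nonpos (by positivity) hr.le (neg_nonpos.2 hs.1.le)).trans
      (div_rpow_neg_le hs ht one_le_two)
  have hux₀ : u x₀ = φ τ + a := by rw [heq, hv, hnorm]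
  have hbr : (u x₀ - u x₀ ^ 3) - (φ τ - φ τ ^ 3)
      = a * (1 - (3 * φ τ ^ 2 + 3 * φ τ * a + a ^ 2)) := by rw [hux₀]; ring
  have hmain' : ∫ w, D w * tker n s δ w ≤ (2 * curvConst n s + 1) * t ^ (-s)
      + Ca * t ^ (-s) * (1 - (3 * φ τ ^ 2 + 3 * φ τ * a + a ^ 2)) := by
    rw [← hlama, mul_assoc, ← hbr]
    have := mul_le_mul_of_nonneg_left hrs hcurv
    linarith
  have hDint0 : 0 ≤ ∫ w, D w * tker n s δ w :=
    integral_nonneg fun w => mul_nonneg (sub_nonneg.2 (hle _)) (tker_nonneg hn hs δ w)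
  constructor
  · by_contra! h
    have h1 := (abs_le.1 (hφ.abs_le τ)).1
    have h2 : 1 - (3 * φ τ ^ 2 + 3 * φ τ * a + a ^ 2) ≤ -1 := by nlinarith
    have h3 := mul_le_mul_of_nonneg_left h2 (by positivity : 0 ≤ Ca * t ^ (-s))
    have h4 : (2 * curvConst n s + 1) * t ^ (-s) < Ca * t ^ (-s) := by
      refine mul_lt_mul_of_pos_right ?_ hts
      rw [hCa, shiftConst]; linarith
    linarith
  · have h2 : 1 - (3 * φ τ ^ 2 + 3 * φ τ * a + a ^ 2) ≤ 1 := by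
      nlinarith [sq_nonneg (φ τ + a), sq_nonneg (φ τ - a), sq_nonneg (2 * φ τ + a)]
    have h3 := mul_le_mul_of_nonneg_left h2 (by positivity : 0 ≤ Ca * t ^ (-s))
    linarith

/-- If a spherical layer touches a solution from above, the solution carries a definite amount
of mass near the touching sphere. -/
theorem exists_mass_of_touch (hn : 1 ≤ n) (hs : s ∈ Ioo (0 : ℝ) 1) :
    ∃ Λ κ c, 40 * shiftConst n s ≤ Λ ∧ 0 < κ ∧ 0 < c ∧
      ∀ (lam K δ t : ℝ) (u : Rn n → ℝ) (O : Set (Rn n)) (φ : ℝ → ℝ) (z x₀ : Rn n),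
        0 < lam → 0 < δ → 0 < t → Λ ≤ lam * t ^ s → δ ≤ κ * t →
        K * (δ ^ (1 - s) * kerMass n s) ≤ t ^ (-s) →
        IsLipSol n s lam K u O → IsLayer n s δ lam φ → ball z (3 * t) ⊆ O →
        (∀ x, u x ≤ sphericalLayer n s lam φ z t x) →
        u x₀ = sphericalLayer n s lam φ z t x₀ →
          c * t ^ n ≤ ∫ x in ball z (3 * t), (1 + u x) := by
  have hα := alphaC_pos hn hs
  have hU := unitVol_pos (n := n)
  have hk := kerMass_nonneg hn hs
  have hcurv := curvConst_nonneg hn hs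
  set Ca := shiftConst n s with hCa
  have hCa0 : 0 < Ca := shiftConst_pos hn hs
  set C4 := 2 * curvConst n s + 1 + Ca with hC4
  obtain ⟨κ, hκ, hκ1, hκs⟩ := exists_pos_rpow_mul_le hs.1 (C4 / alphaC n s) (b := 1) one_pos
    (η := 9 / 10 * (unitVol n * (1 / 4) ^ n)) (by positivity)
  set Λ := max (40 * Ca) (20 * kerMass n s * (κ / 4) ^ (-s)) with hΛ
  refine ⟨Λ, κ, unitVol n * (κ / 4) ^ n, le_max_left _ _, hκ, by positivity, ?_⟩
  intro lam K δ t u O φ z x₀ hlam hδ ht hΛt hδt hKδ hu hφ hO hle heq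
  have hΛ0 : 0 < Λ := lt_of_lt_of_le (by positivity) (le_max_left _ _)
  have hts : 0 < t ^ (-s) := rpow_pos_of_pos ht _
  have hscale : ∀ C, 0 ≤ C → C * t ^ (-s) / lam ≤ C / Λ := fun C hC => by
    have hts' : t ^ (-s) * t ^ s = 1 := by rw [← rpow_add ht]; simp
    rw [div_le_div_iff₀ hlam hΛ0]
    calc C * t ^ (-s) * Λ ≤ C * t ^ (-s) * (lam * t ^ s) := by gcongr
      _ = C * lam * (t ^ (-s) * t ^ s) := by ring
      _ = C * lam := by rw [hts', mul_one]
  set a := Ca * t ^ (-s) / lam with ha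
  have ha0 : 0 < a := by positivity
  have ha1 : a ≤ 1 / 40 := by
    refine (hscale Ca hCa0.le).trans ?_
    rw [div_le_iff₀ hΛ0]
    linarith [le_max_left (40 * Ca) (20 * kerMass n s * (κ / 4) ^ (-s))]
  have hφκ : 9 / 10 ≤ φ (κ * t / 4) := by
    have h1 := hφ.decay (κ * t / 4) (by positivity)
    have h2 : (κ * t / 4) ^ (-s) = (κ / 4) ^ (-s) * t ^ (-s) := by
      rw [← mul_rpow (by positivity) ht.le]; ring_nf
    have hp := rpow_nonneg (by positivity : 0 ≤ κ / 4) (-s)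
    have h3 := hscale (2 * kerMass n s * (κ / 4) ^ (-s)) (by positivity)
    have h4 : 2 * kerMass n s * (κ / 4) ^ (-s) / Λ ≤ 1 / 10 := by
      rw [div_le_iff₀ hΛ0]
      linarith [le_max_right (40 * Ca) (20 * kerMass n s * (κ / 4) ^ (-s))]
    rw [h2, ← mul_assoc] at h1
    linarith
  have hv : ∀ x, sphericalLayer n s lam φ z t x = φ (‖x - z‖ - t) + a := fun x => rfl
  obtain ⟨hr1, hr2⟩ := hφ.touch_radius hn hs hu hlam ht ha1 hO hle heq
  set r := ‖x₀ - z‖ with hr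
  have hr0 : 0 < r := by linarith
  set e : Rn n := r⁻¹ • (x₀ - z) with he_def
  have he : ‖e‖ = 1 := by
    rw [he_def, norm_smul, norm_inv, norm_norm, ← hr, inv_mul_cancel₀ hr0.ne']
  have hxz : x₀ - z = r • e := by rw [he_def, smul_smul, mul_inv_cancel₀ hr0.ne', one_smul]
  obtain ⟨hφτ, hDC4⟩ := hφ.touch_defect_le hn hs hu hlam hδ ht ha1 hKδ
    (hO (show x₀ ∈ ball z (3 * t) by rw [mem_ball, dist_eq_norm]; linarith)) hle heq he hxz hr1
  have hDi := hφ.integrable_defect hn hs hδ hu z x₀ t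
  set τ := r - t with hτ
  set D : Rn n → ℝ := fun w => sphericalLayer n s lam φ z t (x₀ + w) - u (x₀ + w) with hD
  have hD0 : ∀ w, 0 ≤ D w := fun w => sub_nonneg.2 (hle _)
  have hDc : Continuous D := by
    have := hu.continuous
    have := hφ.cont
    simp only [hD, hv]; fun_prop
  have hτκ : -(κ * t / 4) < τ := by
    by_contra! h
    have := hφ.mono h
    rw [hφ.odd] at this
    linarith
  have hκt : 0 < κ * t := by positivity
  set A : Set (Rn n) := ball ((3 / 4 * (κ * t)) • e) (κ * t / 4) with hA
  have hAe : ‖(3 / 4 * (κ * t)) • e‖ = 3 / 4 * (κ * t) := by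
    rw [norm_smul, he, mul_one, norm_of_nonneg (by positivity)]
  have hAnorm : ∀ w ∈ A, ‖w‖ ≤ κ * t := fun w hw => by
    rw [hA, mem_ball, dist_eq_norm] at hw
    have := norm_sub_norm_le w ((3 / 4 * (κ * t)) • e)
    linarith
  have hAin : ∀ w ∈ A, κ * t / 2 ≤ inner ℝ e w := fun w hw => by
    rw [hA, mem_ball, dist_eq_norm] at hw
    have h1 := abs_real_inner_le_norm e (w - (3 / 4 * (κ * t)) • e)
    rw [he, one_mul, inner_sub_right, inner_smul_right, real_inner_self_eq_norm_sq, he] at h1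
    linarith [(abs_le.1 h1).1]
  have hAv : ∀ w ∈ A, 19 / 10 - D w ≤ 1 + u (x₀ + w) := fun w hw => by
    have h1 : r + inner ℝ e w ≤ ‖x₀ + w - z‖ := by
      have := (abs_le.1 (abs_real_inner_le_norm e (x₀ + w - z))).2
      rw [he, one_mul, add_sub_right_comm, hxz, inner_add_right, inner_smul_right,
        real_inner_self_eq_norm_sq, he] at this
      rw [add_sub_right_comm, hxz]
      linarith
    have h2 : φ (κ * t / 4) ≤ φ (‖x₀ + w - z‖ - t) := hφ.mono (by linarith [hAin w hw])
    simp only [hD, hv]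
    linarith
  have hcpos : 0 < alphaC n s * (κ * t) ^ (-((n : ℝ) + s)) := mul_pos hα (rpow_pos_of_pos hκt _)
  have hDA := setIntegral_le_of_le_kernel hcpos (measurableSet_ball : MeasurableSet A) hD0
    (tker_nonneg hn hs δ) (integrableOn_ball_of_continuous hDc _ _) hDi
    (ae_of_all _ fun w hw => le_tker hn hs hδ (hAnorm w hw) hδt)
  have hDA' : ∫ w in A, D w ≤ 9 / 10 * (unitVol n * (1 / 4) ^ n) * (κ ^ n * t ^ n) := by
    refine hDA.trans ((div_le_div_of_nonneg_right hDC4 hcpos.le).trans ?_)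
    rw [div_kernel_scale _ _ hκ ht]
    exact mul_le_mul_of_nonneg_right hκs (by positivity)
  have hconst : IntegrableOn (fun _ => (19 / 10 : ℝ)) A := integrableOn_ball_of_continuous continuous_const _ _
  have hcont := hu.continuous
  have hpt : ∫ w in A, ((19 / 10 : ℝ) - D w) ≤ ∫ w in A, (1 + u (x₀ + w)) :=
    setIntegral_mono_on (hconst.sub (integrableOn_ball_of_continuous hDc _ _)) (integrableOn_ball_of_continuous (by fun_prop) _ _)
      measurableSet_ball hAv
  rw [integral_sub hconst (integrableOn_ball_of_continuous hDc _ _), setIntegral_const, hA,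
    volume_real_ball_Rn _ (by positivity), smul_eq_mul,
    setIntegral_ball_shift (fun y => 1 + u y)] at hpt
  have hmono : ∫ y in ball (x₀ + (3 / 4 * (κ * t)) • e) (κ * t / 4), (1 + u y)
      ≤ ∫ y in ball z (3 * t), (1 + u y) := by
    refine setIntegral_mono_set (integrableOn_ball_of_continuous (by fun_prop) _ _) (ae_of_all _ fun y => ?_)
      (ball_subset_ball' ?_).eventuallyLE
    · have := hu.neg_one_lt y
      simp only [Pi.zero_apply]; linarith
    · rw [dist_eq_norm, add_sub_right_comm]
      have := norm_add_le (x₀ - z) ((3 / 4 * (κ * t)) • e)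
      have : κ * t ≤ t := by nlinarith
      linarith
  have hvol : (κ * t / 4) ^ n = (1 / 4) ^ n * (κ ^ n * t ^ n) := by
    rw [← mul_pow, ← mul_pow]; ring_nf
  have hvol' : (κ / 4) ^ n * t ^ n = (1 / 4) ^ n * (κ ^ n * t ^ n) := by
    rw [← mul_pow, ← mul_pow, ← mul_pow]; ring_nf
  rw [hvol] at hpt
  rw [mul_assoc, hvol']
  linarith

end Touching

section DensityEstimate

variable {n : ℕ} {s : ℝ}

/-- In a continuous one-parameter family of functions on a compact set, there is a first
parameter at which the supremum vanishes. -/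
theorem IsCompact.exists_contact {E : Type*} [TopologicalSpace E] {X : Set E} (hX : IsCompact X)
    {F : ℝ → E → ℝ} (hF : Continuous ↿F) (h0 : ∀ x ∈ X, F 0 x ≤ 0) (h1 : ∃ x ∈ X, 0 < F 1 x) :
    ∃ θ ∈ Icc (0 : ℝ) 1, (∀ x ∈ X, F θ x ≤ 0) ∧ ∃ x ∈ X, F θ x = 0 := by
  obtain ⟨x₁, hx₁, hpos⟩ := h1
  have hne : X.Nonempty := ⟨x₁, hx₁⟩
  have hFθ : ∀ θ, ContinuousOn (F θ) X := fun θ =>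
    (hF.comp (continuous_const.prodMk continuous_id)).continuousOn
  have hbdd : ∀ θ, BddAbove (F θ '' X) := fun θ => (hX.image_of_continuousOn (hFθ θ)).bddAbove
  have hg := hX.continuous_sSup hF
  have hg0 : sSup (F 0 '' X) ≤ 0 := csSup_le (hne.image _) (by rintro _ ⟨x, hx, rfl⟩; exact h0 x hx)
  have hg1 : 0 ≤ sSup (F 1 '' X) := hpos.le.trans (le_csSup (hbdd 1) (mem_image_of_mem _ hx₁))
  obtain ⟨θ, hθ, hθ0⟩ := intermediate_value_Icc zero_le_one hg.continuousOn ⟨hg0, hg1⟩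
  refine ⟨θ, hθ, fun x hx => ?_, ?_⟩
  · rw [← hθ0]
    exact le_csSup (hbdd θ) (mem_image_of_mem _ hx)
  · obtain ⟨x, hx, hmax⟩ := hX.exists_sSup_image_eq hne (hFθ θ)
    exact ⟨x, hx, hmax ▸ hθ0⟩

/-- Sliding a spherical layer: if it starts above `u` but ends up not above `u`, it touches `u`
from above on the way. -/
theorem IsLayer.exists_touch (hn : 1 ≤ n) (hs : s ∈ Ioo (0 : ℝ) 1) {δ lam K R : ℝ}
    {φ : ℝ → ℝ} {u : Rn n → ℝ} {O : Set (Rn n)} {p : Rn n} {z : ℝ → Rn n} {t : ℝ → ℝ}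
    (hφ : IsLayer n s δ lam φ) (hlam : 0 < lam) (hu : IsLipSol n s lam K u O)
    (hz : Continuous z) (ht : Continuous t) (ht0 : ∀ θ, 0 < t θ)
    (hR : ∀ θ ∈ Icc (0 : ℝ) 1, 2 * t θ + ‖z θ - p‖ ≤ R)
    (h0 : ∀ x, u x ≤ sphericalLayer n s lam φ (z 0) (t 0) x)
    (h1 : ∃ x, sphericalLayer n s lam φ (z 1) (t 1) x < u x) :
    ∃ θ ∈ Icc (0 : ℝ) 1, (∀ x, u x ≤ sphericalLayer n s lam φ (z θ) (t θ) x) ∧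
      ∃ x, u x = sphericalLayer n s lam φ (z θ) (t θ) x := by
  have hout : ∀ θ ∈ Icc (0 : ℝ) 1, ∀ x ∉ closedBall p R,
      u x ≤ sphericalLayer n s lam φ (z θ) (t θ) x := fun θ hθ x hx => by
    rw [mem_closedBall, dist_eq_norm, not_le] at hx
    have h2 := norm_sub_le_norm_sub_add_norm_sub x (z θ) p
    have h3 := hR θ hθ
    exact (hu.lt_one x).le.trans (hφ.one_le_sphericalLayer hn hs hlam (ht0 θ) (by linarith))
  have hcont : Continuous
      ↿(fun (θ : ℝ) (x : Rn n) => u x - sphericalLayer n s lam φ (z θ) (t θ) x) := by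
    have hφc := hφ.cont
    have huc := hu.continuous
    have htc : Continuous fun q : ℝ × Rn n => t q.1 ^ (-s) :=
      (ht.comp continuous_fst).rpow_const fun q => Or.inl (ht0 _).ne'
    change Continuous fun q : ℝ × Rn n => u q.2 -
      (φ (‖q.2 - z q.1‖ - t q.1) + shiftConst n s * t q.1 ^ (-s) / lam)
    fun_prop
  obtain ⟨x₁, hx₁⟩ := h1
  have hx₁X : x₁ ∈ closedBall p R := by
    by_contra h
    exact (hout 1 ⟨zero_le_one, le_rfl⟩ x₁ h).not_gt hx₁
  obtain ⟨θ, hθ, hle, x, -, hx⟩ := (isCompact_closedBall p R).exists_contact hcont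
    (fun x _ => sub_nonpos.2 (h0 x)) ⟨x₁, hx₁X, sub_pos.2 hx₁⟩
  refine ⟨θ, hθ, fun y => ?_, x, sub_eq_zero.1 hx⟩
  by_cases hy : y ∈ closedBall p R
  · exact sub_nonpos.1 (hle y hy)
  · exact hout θ hθ y hy

/-- If every point of `S` is the centre of a ball of controlled radius carrying a fixed density
of mass, then the total mass controls the volume of `S`. -/
theorem volume_le_of_forall_ball_mass {f : Rn n → ℝ} (hf : Continuous f) (hf0 : ∀ x, 0 ≤ f x)
    {S : Set (Rn n)} {r : Rn n → ℝ} {p : Rn n} {R ρ a : ℝ} (ha : 0 < a)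
    (hr : ∀ z ∈ S, 0 < r z ∧ r z ≤ ρ ∧ ball z (r z) ⊆ ball p R ∧
      a * r z ^ n ≤ ∫ x in ball z (r z), f x) :
    a * volume.real S ≤ 4 ^ n * unitVol n * ∫ x in ball p R, f x := by
  have hU := unitVol_pos (n := n)
  obtain ⟨J, hJS, hdisj, hcov⟩ := Vitali.exists_disjoint_subfamily_covering_enlargement_closedBall
    S id r ρ (fun z hz => (hr z hz).2.1) 4 (by norm_num)
  simp only [id] at hdisj hcov
  have hdisj' : J.PairwiseDisjoint fun z => ball z (r z) :=
    hdisj.mono fun z => ball_subset_closedBall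
  have hJ : J.Countable := hdisj'.countable_of_isOpen (fun z _ => isOpen_ball)
    fun z hz => nonempty_ball.2 (hr z (hJS hz)).1
  have hlint : ∀ z ρ', ∫⁻ x in ball z ρ', ENNReal.ofReal (f x)
      = ENNReal.ofReal (∫ x in ball z ρ', f x) := fun z ρ' =>
    (ofReal_integral_eq_lintegral_ofReal (integrableOn_ball_of_continuous hf z ρ')
      (ae_of_all _ hf0)).symm
  have hsub : S ⊆ ⋃ z ∈ J, closedBall z (4 * r z) := fun z hz => by
    obtain ⟨b, hb, hzb⟩ := hcov z hz
    exact mem_biUnion hb (hzb (mem_closedBall_self (hr z hz).1.le))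
  have hvol : ∀ z ∈ J, volume (closedBall z (4 * r z)) ≤
      ENNReal.ofReal (4 ^ n * unitVol n / a) * ∫⁻ x in ball z (r z), ENNReal.ofReal (f x) :=
    fun z hz => by
      obtain ⟨h1, -, -, h4⟩ := hr z (hJS hz)
      have h2 : volume (closedBall z (4 * r z)) = ENNReal.ofReal ((4 * r z) ^ n * unitVol n) := by
        rw [Measure.addHaar_closedBall _ _ (by positivity), finrank_euclideanSpace_fin,
          ENNReal.ofReal_mul (by positivity), unitVol, ofReal_measureReal measure_ball_lt_top.ne]
      rw [hlint, ← ENNReal.ofReal_mul (by positivity), h2]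
      refine ENNReal.ofReal_le_ofReal ?_
      calc (4 * r z) ^ n * unitVol n = 4 ^ n * unitVol n / a * (a * r z ^ n) := by
            rw [mul_pow]; field_simp
        _ ≤ _ := by gcongr
  have key : volume S ≤ ENNReal.ofReal (4 ^ n * unitVol n / a * ∫ x in ball p R, f x) := by
    calc volume S ≤ volume (⋃ z ∈ J, closedBall z (4 * r z)) := measure_mono hsub
      _ ≤ ∑' z : J, volume (closedBall (z : Rn n) (4 * r z)) := measure_biUnion_le _ hJ _
      _ ≤ ∑' z : J, ENNReal.ofReal (4 ^ n * unitVol n / a) *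
            ∫⁻ x in ball (z : Rn n) (r z), ENNReal.ofReal (f x) :=
          ENNReal.tsum_le_tsum fun z => hvol z z.2
      _ = ENNReal.ofReal (4 ^ n * unitVol n / a) *
            ∫⁻ x in ⋃ z ∈ J, ball z (r z), ENNReal.ofReal (f x) := by
          rw [ENNReal.tsum_mul_left,
            lintegral_biUnion hJ (fun z _ => measurableSet_ball) hdisj']
      _ ≤ ENNReal.ofReal (4 ^ n * unitVol n / a) * ∫⁻ x in ball p R, ENNReal.ofReal (f x) := by
          gcongr
          exact iUnion₂_subset fun z hz => (hr z (hJS hz)).2.2.1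
      _ = _ := by rw [hlint, ← ENNReal.ofReal_mul (by positivity)]
  have hI : 0 ≤ ∫ x in ball p R, f x := setIntegral_nonneg measurableSet_ball fun x _ => hf0 x
  have h := ENNReal.toReal_mono ENNReal.ofReal_ne_top key
  rw [ENNReal.toReal_ofReal (by positivity)] at h
  calc a * volume.real S ≤ a * (4 ^ n * unitVol n / a * ∫ x in ball p R, f x) := by
        gcongr; exact h
    _ = _ := by field_simp

theorem exists_cutoff (hs : s ∈ Ioo (0 : ℝ) 1) {b C D lam η : ℝ} (hb : 0 < b) (hD : 0 < D)
    (hη : 0 < η) : ∃ δ, 0 < δ ∧ δ ≤ b ∧ C * δ ^ (1 - s) ≤ η ∧ lam < D * δ ^ (-s) := by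
  obtain ⟨δ₁, h1, h1b, hδ₁⟩ := exists_pos_rpow_mul_le (s := 1 - s) (by linarith [hs.2]) C hb hη
  obtain ⟨δ₂, h2, h2b, hδ₂⟩ := exists_pos_rpow_mul_le hs.1 (2 * |lam|) h1 hD
  refine ⟨δ₂, h2, h2b.trans h1b, ?_, ?_⟩
  · rcases le_total 0 C with hC | hC
    · rw [mul_comm]
      refine le_trans ?_ hδ₁
      have := rpow_le_rpow h2.le h2b (by linarith [hs.2] : 0 ≤ 1 - s)
      gcongr
    · exact (mul_nonpos_of_nonpos_of_nonneg hC (by positivity)).trans hη.le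
  · have h3 : 0 < δ₂ ^ s := by positivity
    rw [rpow_neg h2.le, ← div_eq_mul_inv, lt_div_iff₀ h3]
    nlinarith [le_abs_self lam, abs_nonneg lam]

/-- Clean-ball density estimate: small mass of `1 + u` in a ball of radius much larger than the
transition length forces `u` close to `-1` in the concentric ball of half radius. -/
theorem exists_density_estimate (hn : 1 ≤ n) (hs : s ∈ Ioo (0 : ℝ) 1) :
    ∃ ω₀ C₀ : ℝ, 0 < ω₀ ∧ 0 < C₀ ∧ ∀ (R ε K : ℝ) (p : Rn n) (u : Rn n → ℝ), 0 < R → 0 < ε →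
      C₀ * ε ≤ R → IsLipSol n s (ε ^ (-s)) K u (ball p R) →
      ∫ x in ball p R, (1 + u x) ≤ ω₀ * R ^ n → ∀ x ∈ ball p (R / 2), u x < -(9 / 10) := by
  have hk := kerMass_nonneg hn hs
  have hα := alphaC_pos hn hs
  have hU := unitVol_pos (n := n)
  have hS := shiftConst_pos hn hs
  have hcurv := curvConst_nonneg hn hs
  obtain ⟨Λ, κ, c₁, hΛS, hκ, hc₁, htouch⟩ := exists_mass_of_touch hn hs
  have hΛ : 0 < Λ := lt_of_lt_of_le (by positivity) hΛS
  obtain ⟨c₂, hc₂, hpoint⟩ := exists_mass_of_point hn hs hΛ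
  set c := min c₁ c₂ with hc_def
  have hc : 0 < c := lt_min hc₁ hc₂
  refine ⟨c / (2 * 100 ^ n), 100 * Λ ^ (1 / s), by positivity, by positivity,
    fun R ε K p u hR hε hCR hu hmass => ?_⟩
  set lam := ε ^ (-s) with hlam_def
  have hlam : 0 < lam := rpow_pos_of_pos hε _
  set T := R / 100 with hT_def
  set t₁ := Λ ^ (1 / s) * ε with ht₁_def
  have hT : 0 < T := by positivity
  have ht₁ : 0 < t₁ := by positivity
  have ht₁T : t₁ ≤ T := by rw [hT_def, le_div_iff₀ (by norm_num)]; linarith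
  have hlt₁ : lam * t₁ ^ s = Λ := by
    rw [ht₁_def, hlam_def, mul_rpow (by positivity) hε.le, ← rpow_mul hΛ.le,
      one_div_mul_cancel hs.1.ne', rpow_one, rpow_neg hε.le]
    field_simp
  have hlt : ∀ t, t₁ ≤ t → Λ ≤ lam * t ^ s := fun t ht => by
    rw [← hlt₁]
    have := rpow_le_rpow ht₁.le ht hs.1.le
    gcongr
  obtain ⟨δ, hδ, hδt₁, hδK, hδlam⟩ := exists_cutoff hs (b := κ * t₁) (C := K * kerMass n s)
    (D := alphaC n s * unitVol n) (lam := lam) (η := R ^ (-s)) (by positivity) (by positivity)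
    (by positivity)
  obtain ⟨φ, hφo, hφc, hφe, hφd⟩ := exists_layer hn hs hδ hlam
    (hδlam.trans_le (le_tkerMass hn hs hδ))
  have hφ : IsLayer n s δ lam φ := { hφo with cont := hφc, eqn := hφe, decay := hφd }
  have huc : Continuous fun x => 1 + u x := continuous_const.add hu.continuous
  have hu0 : ∀ x, 0 ≤ 1 + u x := fun x => by linarith [hu.neg_one_lt x]
  have hmono : ∀ {z z' : Rn n} {r r' : ℝ}, ball z r ⊆ ball z' r' →
      ∫ x in ball z r, (1 + u x) ≤ ∫ x in ball z' r', (1 + u x) := fun h =>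
    setIntegral_mono_set (integrableOn_ball_of_continuous huc _ _) (ae_of_all _ hu0)
      (ae_of_all _ h)
  have hball : ∀ z ∈ ball p (R / 2), ∀ r ≤ R / 2, ball z r ⊆ ball p R := fun z hz r hr =>
    ball_subset_ball' (by rw [mem_ball] at hz; linarith)
  have htouch' : ∀ z ∈ ball p (R / 2), ∀ t, t₁ ≤ t → t ≤ T →
      (∀ x, u x ≤ sphericalLayer n s lam φ z t x) →
      (∃ x, u x = sphericalLayer n s lam φ z t x) →
      c * t ^ n ≤ ∫ x in ball z (3 * t), (1 + u x) := fun z hz t htt₁ htT hle ⟨x, hx⟩ => by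
    have ht : 0 < t := ht₁.trans_le htt₁
    have htR : R ^ (-s) ≤ t ^ (-s) :=
      rpow_le_rpow_of_nonpos ht (by rw [hT_def] at htT; linarith) (by linarith [hs.1])
    have h1 := htouch lam K δ t u (ball p R) φ z x hlam hδ ht (hlt t htt₁)
      (hδt₁.trans (by gcongr)) (by linarith) hu hφ
      (hball z hz _ (by rw [hT_def] at htT; linarith)) hle hx
    refine le_trans ?_ h1
    gcongr
    exact min_le_left _ _
  have hstart : ∀ z ∈ ball p (R / 2), c * t₁ ^ n ≤ ∫ x in ball z (5 * t₁), (1 + u x) ∨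
      ∀ x, u x ≤ sphericalLayer n s lam φ z t₁ x := fun z hz => by
    by_cases h : ∀ x ∈ ball z (3 * (4 * t₁) / 4), u x ≤ -(9 / 10)
    · right
      intro x
      rcases le_total (2 * t₁) ‖x - z‖ with hx | hx
      · exact (hu.lt_one x).le.trans (hφ.one_le_sphericalLayer hn hs hlam ht₁ hx)
      · have h1 := hu.decay hn hs hlam (by positivity : 0 < 4 * t₁)
          (hball z hz _ (by rw [hT_def] at ht₁T; linarith)) h (x := x) (by linarith)
        have h2 : 8 * kerMass n s * (4 * t₁) ^ (-s) / lam
            ≤ shiftConst n s * t₁ ^ (-s) / lam := by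
          have h3 : (4 * t₁) ^ (-s) ≤ t₁ ^ (-s) :=
            rpow_le_rpow_of_nonpos ht₁ (by linarith) (by linarith [hs.1])
          have h4 : 8 * kerMass n s ≤ shiftConst n s := by rw [shiftConst]; linarith
          gcongr
        have h5 := (abs_le.1 (hφ.abs_le (‖x - z‖ - t₁))).1
        unfold sphericalLayer
        linarith
    · left
      push Not at h
      obtain ⟨x₁, hx₁, hux₁⟩ := h
      rw [mem_ball] at hx₁
      have hsub : ball x₁ (2 * t₁) ⊆ ball z (5 * t₁) := ball_subset_ball' (by linarith)
      have h1 := hpoint lam K t₁ u (ball p R) x₁ ht₁ hlt₁ hu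
        (((ball_subset_ball (by linarith)).trans hsub).trans
          (hball z hz _ (by rw [hT_def] at ht₁T; linarith))) hux₁.le
      refine (le_trans ?_ h1).trans (hmono hsub)
      gcongr
      exact min_le_right _ _
  have halt : ∀ z ∈ ball p (R / 2), (∃ t, t₁ ≤ t ∧ t ≤ T ∧
      c * t ^ n ≤ ∫ x in ball z (5 * t), (1 + u x)) ∨
      ∀ x, u x ≤ sphericalLayer n s lam φ z T x := fun z hz => by
    rcases hstart z hz with h | h
    · exact Or.inl ⟨t₁, le_rfl, ht₁T, h⟩
    · by_contra! hcon
      have hθT : ∀ θ ∈ Icc (0 : ℝ) 1, t₁ ≤ t₁ + |θ| * (T - t₁) ∧ t₁ + |θ| * (T - t₁) ≤ T :=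
        fun θ hθ => by
          rw [abs_of_nonneg hθ.1]
          constructor <;> nlinarith [hθ.1, hθ.2]
      obtain ⟨θ, hθ, hle, hx⟩ := hφ.exists_touch hn hs (p := p) (R := R) (z := fun _ => z)
        (t := fun θ => t₁ + |θ| * (T - t₁)) hlam hu continuous_const (by fun_prop)
        (fun θ => add_pos_of_pos_of_nonneg ht₁
          (mul_nonneg (abs_nonneg θ) (sub_nonneg.2 ht₁T)))
        (fun θ hθ => by
          have h1 := (hθT θ hθ).2
          rw [mem_ball, dist_eq_norm] at hz
          linarith) (by simpa using h) (by simpa using hcon.2)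
      have h2 := htouch' z hz _ (hθT θ hθ).1 (hθT θ hθ).2 hle hx
      refine (hcon.1 _ (hθT θ hθ).1 (hθT θ hθ).2).not_ge (h2.trans (hmono ?_))
      exact ball_subset_ball (by linarith [(hθT θ hθ).1])
  obtain ⟨z₀, hz₀, hbelow⟩ : ∃ z ∈ ball p (R / 2),
      ∀ x, u x ≤ sphericalLayer n s lam φ z T x := by
    by_contra! hcon
    have hall : ∀ z ∈ ball p (R / 2), ∃ t, t₁ ≤ t ∧ t ≤ T ∧
        c * t ^ n ≤ ∫ x in ball z (5 * t), (1 + u x) := fun z hz =>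
      (halt z hz).resolve_right fun h => by
        obtain ⟨x, hx⟩ := hcon z hz
        exact (h x).not_gt hx
    choose! t ht using hall
    have h1 := volume_le_of_forall_ball_mass huc hu0 (S := ball p (R / 2)) (p := p) (R := R)
      (r := fun z => 5 * t z) (ρ := 5 * T) (a := c / 5 ^ n) (by positivity) fun z hz => by
        obtain ⟨h2, h3, h4⟩ := ht z hz
        refine ⟨by linarith, by linarith, hball z hz _ (by rw [hT_def] at h3; linarith), ?_⟩
        rw [mul_pow]
        refine le_trans (le_of_eq ?_) h4
        field_simp
    rw [volume_real_ball_Rn p (by positivity)] at h1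
    have h2 : c / 5 ^ n * ((R / 2) ^ n * unitVol n)
        ≤ 4 ^ n * unitVol n * (c / (2 * 100 ^ n) * R ^ n) := h1.trans (by gcongr)
    have h3 : (100 : ℝ) ^ n = 40 ^ n * (5 / 2) ^ n := by rw [← mul_pow]; norm_num
    have h4 : (40 : ℝ) ^ n = 4 ^ n * (5 ^ n * 2 ^ n) := by rw [← mul_pow, ← mul_pow]; norm_num
    have h5 : (1 : ℝ) ≤ (5 / 2) ^ n := one_le_pow₀ (by norm_num)
    have h6 : 4 ^ n * unitVol n * (c / (2 * 100 ^ n) * R ^ n)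
        = c / 5 ^ n * ((R / 2) ^ n * unitVol n) * (1 / (2 * (5 / 2) ^ n)) := by
      rw [h3, h4, show R ^ n = 2 ^ n * (R / 2) ^ n by rw [← mul_pow]; congr 1; ring]; field_simp
    have h7 : 1 / (2 * (5 / 2 : ℝ) ^ n) < 1 := by
      rw [div_lt_one (by positivity)]; linarith
    have h8 : 0 < c / 5 ^ n * ((R / 2) ^ n * unitVol n) := by positivity
    rw [h6] at h2
    nlinarith
  intro x hx
  have hbelow' : ∀ y, u y ≤ sphericalLayer n s lam φ x T y := by
    by_contra! hcon
    have hseg : ∀ θ ∈ Icc (0 : ℝ) 1, z₀ + θ • (x - z₀) ∈ ball p (R / 2) := fun θ hθ =>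
      (convex_ball p (R / 2)).add_smul_sub_mem hz₀ hx hθ
    obtain ⟨θ, hθ, hle, hy⟩ := hφ.exists_touch hn hs (p := p) (R := R)
      (z := fun θ => z₀ + θ • (x - z₀)) (t := fun _ => T) hlam hu (by fun_prop) continuous_const
      (fun _ => hT)
      (fun θ hθ => by
        have h1 := hseg θ hθ
        rw [mem_ball, dist_eq_norm] at h1
        linarith) (by simpa using hbelow) (by simpa using hcon)
    have h1 := htouch' _ (hseg θ hθ) T ht₁T le_rfl hle hy
    have h2 := (h1.trans (hmono (hball _ (hseg θ hθ) _ (by linarith)))).trans hmass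
    have h3 : c / (2 * 100 ^ n) * R ^ n = c * T ^ n / 2 := by
      rw [hT_def, div_pow]; field_simp
    have h4 : 0 < c * T ^ n := by positivity
    linarith
  have h1 := hbelow' x
  have h2 := hφ.decay T hT
  have h3 : shiftConst n s * T ^ (-s) / lam ≤ 1 / 40 := by
    have h4 := hlt T ht₁T
    have h5 : 0 < T ^ s := by positivity
    rw [rpow_neg hT.le, ← div_eq_mul_inv, div_div, div_le_iff₀ (by positivity)]
    linarith
  have h6 : 2 * kerMass n s * T ^ (-s) / lam ≤ shiftConst n s * T ^ (-s) / lam := by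
    have h7 : 2 * kerMass n s ≤ shiftConst n s := by rw [shiftConst]; linarith
    gcongr
  rw [sphericalLayer, sub_self, norm_zero, zero_sub, hφ.odd] at h1
  linarith

end DensityEstimate

noncomputable section

/-- **Density estimates for finite Morse index solutions** (Proposition 1.8 of the paper,
Euclidean version): there exist `ω₀, C₀ > 0` depending only on `n, s, m` such that for any
solution in `B_R(p)` with index at most `m` and `R ≥ C₀ ε`, smallness of the mass of
`1+u` (resp. `1-u`) in `B_R(p)` forces `u < -9/10` (resp. `u > 9/10`) on `B_{R/2}(p)`. -/
theorem density_estimates_finite_index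
    (n : ℕ) (hn : 1 ≤ n) (s : ℝ) (hs : s ∈ Set.Ioo (0 : ℝ) 1) (m : ℕ) :
    ∃ ω₀ C₀ : ℝ, 0 < ω₀ ∧ 0 < C₀ ∧
    ∀ R ε : ℝ, 0 < R → 0 < ε → C₀ * ε ≤ R → ∀ p : Rn n,
    ∀ u : Rn n → ℝ, (∀ x, u x ∈ Set.Ioo (-1 : ℝ) 1) → ContDiff ℝ 1 u →
      (∃ K : ℝ, ∀ x, ‖fderiv ℝ u x‖ ≤ K) →
      IsACSol n s ε u (Metric.ball p R) →
      ACMorseIndexLE n s ε u (Metric.ball p R) m →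
      ((R ^ (-(n : ℝ)) * (∫ x in Metric.ball p R, |1 + u x|) ≤ ω₀ →
          ∀ x ∈ Metric.ball p (R / 2), u x < -(9 / 10)) ∧
       (R ^ (-(n : ℝ)) * (∫ x in Metric.ball p R, |1 - u x|) ≤ ω₀ →
          ∀ x ∈ Metric.ball p (R / 2), 9 / 10 < u x)) := by
  obtain ⟨ω₀, C₀, hω₀, hC₀, h⟩ := exists_density_estimate hn hs
  refine ⟨ω₀, C₀, hω₀, hC₀, fun R ε hR hε hCR p u hr hu ⟨K, hK⟩ hsol _ => ?_⟩
  have hlip := hsol.isLipSol hr hu hK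
  have hRn : R ^ (-(n : ℝ)) = (R ^ n)⁻¹ := by rw [rpow_neg hR.le, rpow_natCast]
  have hscale : ∀ I : ℝ, R ^ (-(n : ℝ)) * I ≤ ω₀ → I ≤ ω₀ * R ^ n := fun I hI => by
    rwa [hRn, inv_mul_le_iff₀ (by positivity), mul_comm] at hI
  constructor
  · intro hI
    refine h R ε K p u hR hε hCR hlip ((le_of_eq ?_).trans (hscale _ hI))
    exact integral_congr_ae (ae_of_all _ fun x => (abs_of_nonneg (by linarith [(hr x).1])).symm)
  · intro hI x hx
    have := h R ε K p (fun x => -u x) hR hε hCR hlip.neg ((le_of_eq ?_).trans (hscale _ hI)) x hx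
    · linarith
    · refine integral_congr_ae (ae_of_all _ fun x => ?_)
      dsimp only
      rw [abs_of_nonneg (by linarith [(hr x).2])]
      ring

end
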